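/- Suppose γ ≥ ω₁ is an L-cardinal. Then the following are equivalent: (a) WRP^L(γ); (b) for every regular cardinal κ > γ there is X ≺ H_κ with |X| = ω, γ ∈ X, and γ̄ an L-cardinal; (c) for some regular cardinal κ > γ, the set {X : X ≺ H_κ, |X| = ω, γ ∈ X, and γ̄ is an L-cardinal} is stationary; (d) for every F : γ^{<ω} → γ there exists a countable X ⊆ γ closed under F whose order type is an L-cardinal; (e) for every regular cardinal κ > γ, the set {X : X ≺ H_κ, |X| = ω, γ ∈ X, and γ̄ is an L-cardinal} is stationary. -/

import Mathlib

/-!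
Common set-theoretic infrastructure for formalizing the paper
"The strong reflecting property and Harrington's Principle".

We work over Mathlib's `ZFSet.{0}` (a model of ZFC).  First-order satisfaction
for the language of set theory (with two auxiliary unary predicates) is
defined directly; Gödel's constructible hierarchy `L` (and its relativized
versions `L[A]`), hereditarily-small sets `H_κ`, transitive collapses,
clubs, elementary submodels, admissible ordinals, and the various
reflecting properties are all defined from first principles.
-/

noncomputable section
attribute [local instance] Classical.propDecidable
namespace SRPPaper

open ZFSet

/-- Image of a `ZFSet.{0}` under an arbitrary (classically definable) function. -/
def img (f : ZFSet.{0} → ZFSet.{0}) : ZFSet.{0} → ZFSet.{0} :=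
  @ZFSet.image f (Classical.allZFSetDefinable _)

/-! ### First-order formulas and satisfaction -/

/-- First-order formulas in the language `{∈, =, A, B}` where `A`, `B` are
unary predicate symbols; variables are de Bruijn-style indices in `Fin n`. -/
inductive Fml : ℕ → Type
  | mem {n} (i j : Fin n) : Fml n
  | eq {n} (i j : Fin n) : Fml n
  | inA {n} (i : Fin n) : Fml n
  | inB {n} (i : Fin n) : Fml n
  | not {n} : Fml n → Fml n
  | and {n} : Fml n → Fml n → Fml n
  | ex {n} : Fml (n + 1) → Fml n

/-- Satisfaction over the structure `(S, ∈, A, B)`; quantifiers range over `S`,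
the new variable of `ex` gets index `0`. -/
def SatAB (S A B : Set ZFSet.{0}) : ∀ {n}, Fml n → (Fin n → ZFSet.{0}) → Prop
  | _, .mem i j, v => v i ∈ v j
  | _, .eq i j, v => v i = v j
  | _, .inA i, v => v i ∈ A
  | _, .inB i, v => v i ∈ B
  | _, .not φ, v => ¬ SatAB S A B φ v
  | _, .and φ ψ, v => SatAB S A B φ v ∧ SatAB S A B ψ v
  | _, .ex φ, v => ∃ x ∈ S, SatAB S A B φ (Fin.cons x v)

/-- Pure `∈`-satisfaction over the structure `(S, ∈)`. -/
def Sat (S : Set ZFSet.{0}) {n} (φ : Fml n) (v : Fin n → ZFSet.{0}) : Prop :=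
  SatAB S ∅ ∅ φ v

/-- Δ₀ (bounded) formulas. -/
inductive IsDelta0 : ∀ {n}, Fml n → Prop
  | mem {n} (i j : Fin n) : IsDelta0 (.mem i j)
  | eq {n} (i j : Fin n) : IsDelta0 (.eq i j)
  | inA {n} (i : Fin n) : IsDelta0 (.inA i)
  | inB {n} (i : Fin n) : IsDelta0 (.inB i)
  | not {n} {φ : Fml n} : IsDelta0 φ → IsDelta0 (.not φ)
  | and {n} {φ ψ : Fml n} : IsDelta0 φ → IsDelta0 ψ → IsDelta0 (.and φ ψ)
  | bex {n} (j : Fin (n + 1)) {φ : Fml (n + 1)} : j ≠ 0 → IsDelta0 φ →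
      IsDelta0 (.ex (.and (.mem 0 j) φ))

/-- A Gödel code for formulas. -/
def codeF : ∀ {n}, Fml n → ℕ
  | _, .mem i j => Nat.pair 0 (Nat.pair i.val j.val)
  | _, .eq i j => Nat.pair 1 (Nat.pair i.val j.val)
  | _, .inA i => Nat.pair 2 i.val
  | _, .inB i => Nat.pair 3 i.val
  | _, .not φ => Nat.pair 4 (codeF φ)
  | _, .and φ ψ => Nat.pair 5 (Nat.pair (codeF φ) (codeF ψ))
  | _, .ex φ => Nat.pair 6 (codeF φ)

/-! ### Ordinals, von Neumann naturals -/

/-- `x` is a (von Neumann) ordinal: a transitive set of transitive sets. -/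
def IsOrd (x : ZFSet.{0}) : Prop :=
  x.IsTransitive ∧ ∀ y ∈ x, ZFSet.IsTransitive y

/-- `x` is a limit ordinal. -/
def IsLimitOrd (x : ZFSet.{0}) : Prop :=
  IsOrd x ∧ x ≠ ∅ ∧ ∀ y ∈ x, ∃ z ∈ x, y ∈ z

/-- The `n`-th von Neumann natural number. -/
def natZ : ℕ → ZFSet.{0}
  | 0 => ∅
  | n + 1 => insert (natZ n) (natZ n)

/-- Decoding of von Neumann naturals. -/
def zfToNat (x : ZFSet.{0}) : ℕ :=
  if h : ∃ n : ℕ, natZ n = x then h.choose else 0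

/-! ### Coded functions, products -/

/-- The cartesian product of two `ZFSet.{0}`s (as a set of Kuratowski pairs). -/
def prodZ (a b : ZFSet.{0}) : ZFSet.{0} :=
  ZFSet.sep (fun z => ∃ x, x ∈ a ∧ ∃ y, y ∈ b ∧ z = ZFSet.pair x y)
    (ZFSet.powerset (ZFSet.powerset (a ∪ b)))

/-- `f` codes a surjection from `a` onto `b`. -/
def IsSurjF (a b f : ZFSet.{0}) : Prop :=
  ZFSet.IsFunc a b f ∧ ∀ y, y ∈ b → ∃ x, x ∈ a ∧ ZFSet.pair x y ∈ f

/-- `f` codes an injection from `a` into `b`. -/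
def IsInjF (a b f : ZFSet.{0}) : Prop :=
  ZFSet.IsFunc a b f ∧
    ∀ x₁, x₁ ∈ a → ∀ x₂, x₂ ∈ a → ∀ y, ZFSet.pair x₁ y ∈ f → ZFSet.pair x₂ y ∈ f → x₁ = x₂

/-- The set of values of a coded function `f`. -/
def imageOf (f : ZFSet.{0}) : ZFSet.{0} :=
  ZFSet.sep (fun y => ∃ x, ZFSet.pair x y ∈ f) (ZFSet.sUnion (ZFSet.sUnion f))

/-! ### Cardinals (in `V`) -/

/-- `x` and `y` are equinumerous. -/
def EqNum (x y : ZFSet.{0}) : Prop := Nonempty (x.toSet ≃ y.toSet)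

/-- `|x| ≤ |y|`. -/
def CardLE (x y : ZFSet.{0}) : Prop := Nonempty (x.toSet ↪ y.toSet)

/-- `|x| < κ`, for `κ` a cardinal: `x` injects into some member of `κ`. -/
def CardLT (x κ : ZFSet.{0}) : Prop := ∃ α, α ∈ κ ∧ CardLE x α

/-- `κ` is a cardinal (of `V`). -/
def IsCard (κ : ZFSet.{0}) : Prop := IsOrd κ ∧ ∀ α ∈ κ, ¬ EqNum α κ

/-- `x` is unbounded (cofinal) in the ordinal `κ`. -/
def UnbIn (x κ : ZFSet.{0}) : Prop := ∀ β ∈ κ, ∃ γ ∈ x, β ∈ γ ∨ β = γ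

/-- `κ` is a regular cardinal: every cofinal subset of `κ` has size `κ`. -/
def IsRegular (κ : ZFSet.{0}) : Prop :=
  IsCard κ ∧ ∀ x : ZFSet.{0}, x ⊆ κ → UnbIn x κ → EqNum x κ

/-- The least ordinal satisfying `p` (junk value `∅` if there is none). -/
def leastOrd (p : ZFSet.{0} → Prop) : ZFSet.{0} :=
  if h : ∃ α, (IsOrd α ∧ p α) ∧ ∀ β ∈ α, ¬ (IsOrd β ∧ p β) then h.choose else ∅

/-- The cardinal `ℵₙ` of `V` (`Aleph 0 = ω`). -/
def Aleph : ℕ → ZFSet.{0}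
  | 0 => ZFSet.omega
  | n + 1 => leastOrd (fun κ => IsCard κ ∧ Aleph n ∈ κ)

/-- The cardinal successor (in `V`) of `κ`. -/
def SuccCard (κ : ZFSet.{0}) : ZFSet.{0} := leastOrd (fun α => IsCard α ∧ κ ∈ α)

/-- `X` is countable. -/
def Ctbl (X : ZFSet.{0}) : Prop := X.toSet.Countable

/-- `|X| = ω`: `X` is countably infinite. -/
def CtblInf (X : ZFSet.{0}) : Prop := X.toSet.Countable ∧ X.toSet.Infinite

/-! ### `H_κ`, elementary submodels, transitive collapse -/

/-- The class `H_κ` of sets hereditarily of cardinality `< κ`. -/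
def Hset (κ : ZFSet.{0}) : Set ZFSet.{0} :=
  {x | ∃ t : ZFSet.{0}, t.IsTransitive ∧ x ∈ t ∧ CardLT t κ}

/-- `X ≺ S`: `X` is an elementary submodel of the class `(S, ∈)`. -/
def ElemSub (X : ZFSet.{0}) (S : Set ZFSet.{0}) : Prop :=
  X.toSet ⊆ S ∧ ∀ {n : ℕ} (φ : Fml n) (v : Fin n → ZFSet.{0}),
    (∀ i, v i ∈ X) → (Sat X.toSet φ v ↔ Sat S φ v)

/-- The transitive-collapse map of (the ∈-structure on) `X`:
`collapse X y = {collapse X z | z ∈ y ∩ X}`.  For `γ ∈ X`, `collapse X γ` is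
the image `γ̄` of `γ` under the transitive collapse of `X`. -/
def collapse (X : ZFSet.{0}) : ZFSet.{0} → ZFSet.{0} :=
  ZFSet.mem_wf.fix (C := fun _ => ZFSet.{0}) fun y ih =>
    img (fun z => if h : z ∈ y then ih z h else ∅) (ZFSet.sep (fun z => z ∈ X) y)

/-- The transitive collapse of `X` (as a set). -/
def collapseSet (X : ZFSet.{0}) : ZFSet.{0} := img (fun y => collapse X y) X

/-- The transitive closure of (the members of) `x`. -/
def tcl : ZFSet.{0} → ZFSet.{0} :=
  ZFSet.mem_wf.fix (C := fun _ => ZFSet.{0}) fun x ih =>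
    x ∪ ZFSet.sUnion (img (fun y => if h : y ∈ x then ih y h else ∅) x)

/-- The (von Neumann) rank of a set, as an ordinal `ZFSet.{0}`. -/
def rankZ : ZFSet.{0} → ZFSet.{0} :=
  ZFSet.mem_wf.fix (C := fun _ => ZFSet.{0}) fun x ih =>
    ZFSet.sUnion (img (fun y => if h : y ∈ x then insert (ih y h) (ih y h) else ∅) x)

/-- The order type of a set `X` of ordinals: the unique ordinal `α` such that
`(X, ∈) ≅ (α, ∈)` (junk value `∅` if there is none). -/
def otype (X : ZFSet.{0}) : ZFSet.{0} :=
  if h : ∃ α, IsOrd α ∧ ∃ e : X.toSet ≃ α.toSet,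
      ∀ a b : X.toSet, (a : ZFSet.{0}) ∈ (b : ZFSet.{0}) ↔ ((e a : ZFSet.{0}) ∈ (e b : ZFSet.{0}))
  then h.choose else ∅

/-! ### The constructible hierarchy (relative to a predicate) -/

/-- The set of subsets of `X` definable over `(X, ∈, A)` with parameters. -/
def DefSetA (A : Set ZFSet.{0}) (X : ZFSet.{0}) : ZFSet.{0} :=
  ZFSet.sep (fun B => ∃ (n : ℕ) (φ : Fml (n + 1)) (v : Fin n → ZFSet.{0}),
      (∀ i, v i ∈ X) ∧ B = ZFSet.sep (fun z => SatAB X.toSet A ∅ φ (Fin.cons z v)) X)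
    (ZFSet.powerset X)

/-- The hierarchy `L_α[A]`: `LstageA A α = ⋃_{β ∈ α} Def_A (LstageA A β)`. -/
def LstageA (A : Set ZFSet.{0}) : ZFSet.{0} → ZFSet.{0} :=
  ZFSet.mem_wf.fix (C := fun _ => ZFSet.{0}) fun α ih =>
    ZFSet.sUnion (img (fun β => if h : β ∈ α then DefSetA A (ih β h) else ∅) α)

/-- Gödel's hierarchy `L_α`. -/
def Lstage : ZFSet.{0} → ZFSet.{0} := LstageA ∅

/-- The constructible universe `L`, as a class. -/
def LClass : Set ZFSet.{0} := {x | ∃ α, IsOrd α ∧ x ∈ Lstage α}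

/-- The class `L[A]`, for a set `A`. -/
def LrelClass (A : ZFSet.{0}) : Set ZFSet.{0} := {x | ∃ α, IsOrd α ∧ x ∈ LstageA A.toSet α}

/-- The constructible universe as computed inside a transitive (set or class)
model `W`: the union of the `L_α` for `α` an ordinal of `W`. -/
def LClassIn (W : Set ZFSet.{0}) : Set ZFSet.{0} :=
  {x | ∃ α, IsOrd α ∧ α ∈ W ∧ x ∈ Lstage α}

/-- `κ` is a cardinal in the (transitive) class `W`:
no coded surjection lying in `W` maps some `α < κ` onto `κ`. -/
def CardIn (W : Set ZFSet.{0}) (κ : ZFSet.{0}) : Prop :=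
  IsOrd κ ∧ ∀ α, α ∈ κ → ∀ f, f ∈ W → ¬ IsSurjF α κ f

/-- `κ` is an `L`-cardinal. -/
def LCard (κ : ZFSet.{0}) : Prop := CardIn LClass κ

/-! ### Clubs and stationarity on `[S]^ω` and on `κ` -/

/-- The union of an `ℕ`-indexed family of `ZFSet.{0}`s. -/
def seqUnion (f : ℕ → ZFSet.{0}) : ZFSet.{0} :=
  ZFSet.sUnion (img (fun m => f (zfToNat m)) ZFSet.omega)

/-- `C` is a club of countable subsets of `S`: every member is a countable
subset of `S`, `C` is `⊆`-cofinal in the countable subsets of `S`, and `C` is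
closed under unions of countable increasing chains. -/
def ClubSub (S : Set ZFSet.{0}) (C : Set ZFSet.{0}) : Prop :=
  (∀ X ∈ C, (X : ZFSet.{0}).toSet ⊆ S ∧ CtblInf X) ∧
  (∀ X : ZFSet.{0}, X.toSet ⊆ S → CtblInf X → ∃ Y ∈ C, X ⊆ Y) ∧
  (∀ f : ℕ → ZFSet.{0}, (∀ n, f n ∈ C) → (∀ n, f n ⊆ f (n + 1)) → seqUnion f ∈ C)

/-- `C` is stationary in `[S]^ω`: it meets every club of countable subsets. -/
def StatSub (S : Set ZFSet.{0}) (C : Set ZFSet.{0}) : Prop :=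
  ∀ D : Set ZFSet.{0}, ClubSub S D → ∃ X, X ∈ C ∧ X ∈ D

/-- `D` is a club (closed unbounded set) in the ordinal `κ`. -/
def ClubIn (κ D : ZFSet.{0}) : Prop :=
  D ⊆ κ ∧ (∀ β ∈ κ, ∃ θ, θ ∈ D ∧ β ∈ θ) ∧
  ∀ α, α ∈ κ → α ≠ ∅ → (∀ β ∈ α, ∃ θ, θ ∈ D ∧ θ ∈ α ∧ (β ∈ θ ∨ β = θ)) → α ∈ D

/-- `D` is stationary in the ordinal `κ`. -/
def StatIn (κ D : ZFSet.{0}) : Prop :=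
  D ⊆ κ ∧ ∀ C : ZFSet.{0}, ClubIn κ C → ∃ θ, θ ∈ D ∧ θ ∈ C

/-! ### The strong and weak reflecting properties -/

/-- `SRP^M(γ)` for an inner model given as a class `W`:  for some regular
cardinal `κ > γ`, whenever `X ≺ H_κ` is countable with `γ ∈ X`, the image of
`γ` under the transitive collapse of `X` is a cardinal of `W`. -/
def SRPclass (W : Set ZFSet.{0}) (γ : ZFSet.{0}) : Prop :=
  ∃ κ, IsRegular κ ∧ γ ∈ κ ∧
    ∀ X : ZFSet.{0}, ElemSub X (Hset κ) → CtblInf X → γ ∈ X → CardIn W (collapse X γ)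

/-- `SRP^L(γ)`: the strong reflecting property for `L`-cardinals. -/
def SRPL (γ : ZFSet.{0}) : Prop := SRPclass LClass γ

/-- `WRP^L(γ)`: the weak reflecting property for `L`-cardinals. -/
def WRPL (γ : ZFSet.{0}) : Prop :=
  ∃ κ, IsRegular κ ∧ γ ∈ κ ∧
    ∃ X : ZFSet.{0}, ElemSub X (Hset κ) ∧ CtblInf X ∧ γ ∈ X ∧ LCard (collapse X γ)

/-- `SRP^M_{<λ}(λ)`: for some regular `θ > λ`, every `X ≺ H_θ` with `|X| < λ`
and `λ ∈ X` collapses `λ` to a `W`-cardinal. -/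
def SRPlt (W : Set ZFSet.{0}) (lam : ZFSet.{0}) : Prop :=
  ∃ θ, IsRegular θ ∧ lam ∈ θ ∧
    ∀ X : ZFSet.{0}, ElemSub X (Hset θ) → CardLT X lam → lam ∈ X → CardIn W (collapse X lam)

/-! ### Notions relativized to a transitive (set or class) model `W` -/

/-- `κ` is a regular cardinal in `W`: `κ` is a `W`-cardinal and every coded
function in `W` from some `α < κ` into `κ` is bounded. -/
def RegularIn (W : Set ZFSet.{0}) (κ : ZFSet.{0}) : Prop :=
  CardIn W κ ∧ ∀ α, α ∈ κ → ∀ f, f ∈ W → ZFSet.IsFunc α κ f →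
    ∃ β, β ∈ κ ∧ ∀ ξ y, ξ ∈ α → ZFSet.pair ξ y ∈ f → y ∈ β

/-- `H_κ` as computed in `W`. -/
def HsetIn (W : Set ZFSet.{0}) (κ : ZFSet.{0}) : Set ZFSet.{0} :=
  {x | x ∈ W ∧ ∃ t, t ∈ W ∧ t.IsTransitive ∧ x ∈ t ∧
    ∃ f, f ∈ W ∧ ∃ α, α ∈ κ ∧ IsInjF t α f}

/-- `X` is countable in `W`. -/
def CtblIn (W : Set ZFSet.{0}) (X : ZFSet.{0}) : Prop :=
  X = ∅ ∨ ∃ f, f ∈ W ∧ IsSurjF ZFSet.omega X f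

/-- `|X| = ω` in `W`: countable and infinite in `W`. -/
def CtblInfIn (W : Set ZFSet.{0}) (X : ZFSet.{0}) : Prop :=
  CtblIn W X ∧ ∀ n, n ∈ ZFSet.omega → ∀ f, f ∈ W → ¬ IsSurjF n X f

/-- The `ω₁` of `W`. -/
def omega1In (W : Set ZFSet.{0}) : ZFSet.{0} :=
  leastOrd (fun α => CardIn W α ∧ ZFSet.omega ∈ α)

/-- The `ω₂` of `W`. -/
def omega2In (W : Set ZFSet.{0}) : ZFSet.{0} :=
  leastOrd (fun α => CardIn W α ∧ omega1In W ∈ α)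

/-- The cardinal successor of `κ` as computed in `W`. -/
def SuccCardIn (W : Set ZFSet.{0}) (κ : ZFSet.{0}) : ZFSet.{0} :=
  leastOrd (fun α => CardIn W α ∧ κ ∈ α)

/-- `WRP^L(γ)` as computed inside the (transitive) model `W`:  for some
`κ ∈ W` regular in `W` with `γ < κ` there is an `X ∈ W`, countably infinite
in `W`, with `X ≺ H_κ^W`, `γ ∈ X`, whose collapse sends `γ` to a cardinal of
the `L` of `W`. -/
def WRPLIn (W : Set ZFSet.{0}) (γ : ZFSet.{0}) : Prop :=
  ∃ κ, κ ∈ W ∧ RegularIn W κ ∧ γ ∈ κ ∧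
    ∃ X, X ∈ W ∧ ElemSub X (HsetIn W κ) ∧ CtblInfIn W X ∧ γ ∈ X ∧
      CardIn (LClassIn W) (collapse X γ)

/-- `SRP^L(γ)` as computed inside the (transitive) model `W`. -/
def SRPLIn (W : Set ZFSet.{0}) (γ : ZFSet.{0}) : Prop :=
  ∃ κ, κ ∈ W ∧ RegularIn W κ ∧ γ ∈ κ ∧
    ∀ X, X ∈ W → ElemSub X (HsetIn W κ) → CtblInfIn W X → γ ∈ X →
      CardIn (LClassIn W) (collapse X γ)

/-! ### Models of (fragments of) ZFC, semantically -/

/-- `W` is a transitive model of `ZFC⁻` (ZFC with Power Set deleted and with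
Collection), rendered semantically: nonempty, transitive, closed under
pairing and union, contains `ω`, satisfies full Separation and Collection for
first-order formulas with parameters, and Choice. -/
def ModelsZFCminus (W : Set ZFSet.{0}) : Prop :=
  (∃ x, x ∈ W) ∧
  (∀ x, x ∈ W → x.toSet ⊆ W) ∧
  (∀ x y, x ∈ W → y ∈ W → insert x (insert y (∅ : ZFSet.{0})) ∈ W) ∧
  (∀ x, x ∈ W → ZFSet.sUnion x ∈ W) ∧
  (ZFSet.omega ∈ W) ∧
  (∀ (n : ℕ) (φ : Fml (n + 1)) (v : Fin n → ZFSet.{0}), (∀ i, v i ∈ W) → ∀ a, a ∈ W →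
    ZFSet.sep (fun z => SatAB W ∅ ∅ φ (Fin.cons z v)) a ∈ W) ∧
  (∀ (n : ℕ) (φ : Fml (n + 2)) (v : Fin n → ZFSet.{0}), (∀ i, v i ∈ W) → ∀ a, a ∈ W →
    (∀ x, x ∈ a → ∃ y, y ∈ W ∧ SatAB W ∅ ∅ φ (Fin.cons x (Fin.cons y v))) →
    ∃ b, b ∈ W ∧ ∀ x, x ∈ a → ∃ y, y ∈ b ∧ SatAB W ∅ ∅ φ (Fin.cons x (Fin.cons y v))) ∧
  (∀ x, x ∈ W → (∀ y, y ∈ x → y ≠ ∅) →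
    ∃ c, c ∈ W ∧ ∀ y, y ∈ x → ∃! z, z ∈ y ∧ ZFSet.pair y z ∈ c)

/-- `W` is a transitive model of `ZFC` (with Power Set). -/
def ModelsZFC (W : Set ZFSet.{0}) : Prop :=
  ModelsZFCminus W ∧ ∀ x, x ∈ W → ∃ p, p ∈ W ∧ ∀ z, z ∈ W → (z ∈ p ↔ z ⊆ x)

/-- `W` is a model of `Z₂ = ZFC⁻ +` "every set is countable". -/
def ModelsZ2 (W : Set ZFSet.{0}) : Prop :=
  ModelsZFCminus W ∧ ∀ x, x ∈ W → CtblIn W x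

/-- `p` is the power set of `x` as computed in `W`. -/
def IsPowIn (W : Set ZFSet.{0}) (x p : ZFSet.{0}) : Prop :=
  p ∈ W ∧ ∀ z, z ∈ W → (z ∈ p ↔ z ⊆ x)

/-- `W` is a model of `Z₃ = ZFC⁻ + 𝒫(ω)` exists `+` every set has size `≤ ℶ₁`. -/
def ModelsZ3 (W : Set ZFSet.{0}) : Prop :=
  ModelsZFCminus W ∧ (∃ p, IsPowIn W ZFSet.omega p) ∧
    ∀ x, x ∈ W → ∀ p, IsPowIn W ZFSet.omega p → ∃ f, f ∈ W ∧ IsInjF x p f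

/-- `W` is a model of `Z₄ = ZFC⁻ + 𝒫(𝒫(ω))` exists `+` every set has size `≤ ℶ₂`. -/
def ModelsZ4 (W : Set ZFSet.{0}) : Prop :=
  ModelsZFCminus W ∧
    (∃ p q, IsPowIn W ZFSet.omega p ∧ IsPowIn W p q) ∧
    ∀ x, x ∈ W → ∀ p q, IsPowIn W ZFSet.omega p → IsPowIn W p q →
      ∃ f, f ∈ W ∧ IsInjF x q f

/-! ### Forcing: the Lévy collapse, genericity, generic extensions -/

/-- The Lévy collapse `Col(ω, <κ)`: finite partial functions `p` with
`p(α, n) ∈ α` for `α < κ`, `n < ω`. -/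
def ColLt (κ : ZFSet.{0}) : ZFSet.{0} :=
  ZFSet.sep (fun p => p.toSet.Finite ∧
      (∀ z, z ∈ p → ∃ α n β, α ∈ κ ∧ n ∈ ZFSet.omega ∧ β ∈ α ∧
        z = ZFSet.pair (ZFSet.pair α n) β) ∧
      (∀ α n β β', ZFSet.pair (ZFSet.pair α n) β ∈ p →
        ZFSet.pair (ZFSet.pair α n) β' ∈ p → β = β'))
    (ZFSet.powerset (prodZ (prodZ κ ZFSet.omega) (ZFSet.sUnion κ)))

/-- `G` is a filter on the partial order `P` of partial functions ordered by
reverse inclusion (`p` is stronger than `q` iff `q ⊆ p`) which meets every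
dense subset of `P` lying in the (transitive) model `W`. -/
def GenericOver (W : Set ZFSet.{0}) (P G : ZFSet.{0}) : Prop :=
  G ⊆ P ∧
  (∀ p q, p ∈ G → q ∈ P → q ⊆ p → q ∈ G) ∧
  (∀ p q, p ∈ G → q ∈ G → ∃ r, r ∈ G ∧ p ⊆ r ∧ q ⊆ r) ∧
  (∀ D, D ∈ W → D ⊆ P → (∀ p, p ∈ P → ∃ q, q ∈ D ∧ p ⊆ q) → ∃ q, q ∈ G ∧ q ∈ D)

/-- Genericity for an abstract partial order `R` (a set of pairs) on `P`:
`pair p q ∈ R` means `p` is stronger than (extends) `q`. -/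
def GenericOnP (W : Set ZFSet.{0}) (P R G : ZFSet.{0}) : Prop :=
  G ⊆ P ∧
  (∀ p q, p ∈ G → q ∈ P → ZFSet.pair p q ∈ R → q ∈ G) ∧
  (∀ p q, p ∈ G → q ∈ G → ∃ r, r ∈ G ∧ ZFSet.pair r p ∈ R ∧ ZFSet.pair r q ∈ R) ∧
  (∀ D, D ∈ W → D ⊆ P → (∀ p, p ∈ P → ∃ q, q ∈ D ∧ ZFSet.pair q p ∈ R) →
    ∃ q, q ∈ G ∧ q ∈ D)

/-- Evaluation of a forcing name `τ` by a filter `G`: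
`nameVal G τ = {nameVal G σ | ∃ p ∈ G, (σ, p) ∈ τ}`. -/
def nameVal (G : ZFSet.{0}) : ZFSet.{0} → ZFSet.{0} :=
  (ZFSet.mem_wf.transGen).fix (C := fun _ => ZFSet.{0}) fun τ ih =>
    img (fun σ => if h : Relation.TransGen (· ∈ ·) σ τ then ih σ h else ∅)
      (ZFSet.sep (fun σ => ∃ p, p ∈ G ∧ ZFSet.pair σ p ∈ τ)
        (ZFSet.sUnion (ZFSet.sUnion τ)))

/-- The generic extension `M[G]` of a transitive set model `M`, via names. -/
def extSet (M G : ZFSet.{0}) : Set ZFSet.{0} := {x | ∃ τ, τ ∈ M ∧ x = nameVal G τ}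

/-! ### Remarkable cardinals (Schindler), relative to a ground model class -/

/-- Clubs of countable subsets of `S`, as computed in the (transitive) model
`E`: the club is coded by a set `D ∈ E`, its members are subsets of `S`
countably infinite in `E`, it is cofinal among such sets lying in `E`, and it
is closed under unions of increasing `ω`-chains coded in `E`. -/
def ClubSubIn (E : Set ZFSet.{0}) (S : Set ZFSet.{0}) (D : ZFSet.{0}) : Prop :=
  D ∈ E ∧
  (∀ X, X ∈ D → X.toSet ⊆ S ∧ CtblInfIn E X) ∧
  (∀ X : ZFSet.{0}, X ∈ E → X.toSet ⊆ S → CtblInfIn E X → ∃ Y, Y ∈ D ∧ X ⊆ Y) ∧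
  (∀ g, g ∈ E → ZFSet.IsFunc ZFSet.omega D g →
    (∀ n y y', n ∈ ZFSet.omega → ZFSet.pair n y ∈ g →
      ZFSet.pair (insert n n) y' ∈ g → y ⊆ y') →
    ZFSet.sUnion (imageOf g) ∈ D)

/-- Stationarity of a collection `C` of countable subsets of `S`, as computed
in the model `E`. -/
def StatSubIn (E : Set ZFSet.{0}) (S : Set ZFSet.{0}) (C : Set ZFSet.{0}) : Prop :=
  ∀ D : ZFSet.{0}, ClubSubIn E S D → ∃ X, X ∈ C ∧ X ∈ D

/-- `X` condenses remarkably (with ground model `W`, extension operation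
`Ext` sending a generic object to the corresponding extension of `W`,
collapse height `δ`, target `θ`, and generic `G`):  `X = ran(π)` for some
elementary `π : (H_β^{W[G∩H_α^W]}, ∈, H_β^W, G∩H_α^W) → (H_θ^{W[G]}, ∈, H_θ^W, G)`
with `α = crit(π) < β < δ` and `β` a cardinal of `W`. -/
def CondensesRemarkably (W : Set ZFSet.{0}) (Ext : ZFSet.{0} → Set ZFSet.{0})
    (δ θ G X : ZFSet.{0}) : Prop :=
  ∃ (f : ZFSet.{0} → ZFSet.{0}) (α β : ZFSet.{0}), IsOrd α ∧ α ∈ β ∧ β ∈ δ ∧ CardIn W β ∧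
    (∀ ξ, ξ ∈ α → f ξ = ξ) ∧ f α ≠ α ∧
    (let Gα : ZFSet.{0} := ZFSet.sep (fun p => p ∈ HsetIn W α) G
     let Dom : Set ZFSet.{0} := HsetIn (Ext Gα) β
     let Cod : Set ZFSet.{0} := HsetIn (Ext G) θ
     Set.MapsTo f Dom Cod ∧ X.toSet = f '' Dom ∧
     ∀ (n : ℕ) (φ : Fml n) (v : Fin n → ZFSet.{0}), (∀ i, v i ∈ Dom) →
       (SatAB Dom W Gα.toSet φ v ↔ SatAB Cod W G.toSet φ (f ∘ v)))

/-- `δ` is `θ`-remarkable, in the sense of the (transitive) ground model `W`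
with extensions given by `Ext`: for every `G` which is `Col(ω, <δ)`-generic
over `W`, in `W[G]` the set of countable `X ⊆ H_θ^{W[G]}` which condense
remarkably is stationary. -/
def ThetaRemarkableVia (W : Set ZFSet.{0}) (Ext : ZFSet.{0} → Set ZFSet.{0})
    (δ θ : ZFSet.{0}) : Prop :=
  ∀ G, GenericOver W (ColLt δ) G →
    StatSubIn (Ext G) (HsetIn (Ext G) θ)
      {X | CondensesRemarkably W Ext δ θ G X}

/-- `δ` is remarkable in the sense of `(W, Ext)`:  `θ`-remarkable for every
regular (in `W`) `θ > δ`. -/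
def RemarkableVia (W : Set ZFSet.{0}) (Ext : ZFSet.{0} → Set ZFSet.{0}) (δ : ZFSet.{0}) : Prop :=
  ∀ θ, RegularIn W θ → δ ∈ θ → ThetaRemarkableVia W Ext δ θ

/-! ### Indiscernibles and sharps -/

/-- `I` is a set (or class) of ordinal indiscernibles for the structure
`(S, ∈, A)`. -/
def IndiscFor (S A : Set ZFSet.{0}) (I : Set ZFSet.{0}) : Prop :=
  (∀ x ∈ I, IsOrd x ∧ x ∈ S) ∧
  ∀ (n : ℕ) (φ : Fml n) (v w : Fin n → ZFSet.{0}),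
    (∀ i, v i ∈ I) → (∀ i, w i ∈ I) →
    (∀ i j : Fin n, i < j → v i ∈ v j) → (∀ i j : Fin n, i < j → w i ∈ w j) →
    (SatAB S A ∅ φ v ↔ SatAB S A ∅ φ w)

/-- `0♯` exists: for some uncountable limit ordinal `λ`, `L_λ` has an
uncountable set of indiscernibles. -/
def ZeroSharpExists : Prop :=
  ∃ lam : ZFSet.{0}, IsLimitOrd lam ∧ ¬ lam.toSet.Countable ∧
    ∃ I : ZFSet.{0}, ¬ I.toSet.Countable ∧ IndiscFor (Lstage lam).toSet ∅ I.toSet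

/-- The sharp of `L[A]` exists: for some uncountable limit ordinal `λ`, the
structure `(L_λ[A], ∈, A)` has an uncountable set of indiscernibles. -/
def SharpOverExists (A : ZFSet.{0}) : Prop :=
  ∃ lam : ZFSet.{0}, IsLimitOrd lam ∧ ¬ lam.toSet.Countable ∧
    ∃ I : ZFSet.{0}, ¬ I.toSet.Countable ∧
      IndiscFor (LstageA A.toSet lam).toSet A.toSet I.toSet

/-- `I` is a closed unbounded proper class of ordinals. -/
def ProperClassClub (I : Set ZFSet.{0}) : Prop :=
  (∀ x ∈ I, IsOrd x) ∧
  (∀ α, IsOrd α → ∃ β, IsOrd β ∧ α ∈ β ∧ β ∈ I) ∧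
  (∀ α, IsOrd α → α ≠ ∅ → (∀ β ∈ α, ∃ θ, θ ∈ I ∧ θ ∈ α ∧ (β ∈ θ ∨ β = θ)) → α ∈ I)

/-- `s` is (a real coding) `0♯`: there is a closed unbounded proper class `I`
of Silver indiscernibles for `L` and `s` is the set of codes of formulas
satisfied in `L` by increasing tuples from `I`. -/
def IsZeroSharpReal (s : ZFSet.{0}) : Prop :=
  s ⊆ ZFSet.omega ∧
  ∃ I : Set ZFSet.{0}, ProperClassClub I ∧ IndiscFor LClass ∅ I ∧
    s = ZFSet.sep (fun m => ∃ (n : ℕ) (φ : Fml n) (v : Fin n → ZFSet.{0}),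
          (∀ i, v i ∈ I) ∧ (∀ i j : Fin n, i < j → v i ∈ v j) ∧
          Sat LClass φ v ∧ m = natZ (Nat.pair n (codeF φ))) ZFSet.omega

/-! ### Admissible ordinals and Harrington's Principle -/

/-- The (graph of the) function `f` is `Σ₁`-definable with parameters over the
structure `(S, ∈)`. -/
def Sigma1DefOver (S : Set ZFSet.{0}) (f : ZFSet.{0} → ZFSet.{0}) : Prop :=
  ∃ (n : ℕ) (ψ : Fml (n + 3)), IsDelta0 ψ ∧
    ∃ p : Fin n → ZFSet.{0}, (∀ i, p i ∈ S) ∧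
      ∀ a b, a ∈ S → b ∈ S →
        (f a = b ↔ Sat S (Fml.ex ψ) (Fin.cons a (Fin.cons b p)))

/-- `α` is `x`-admissible: `α > ω` is a limit ordinal and no
`Σ₁(L_α[x])`-definable function maps some `δ < α` cofinally into `α`. -/
def Admissible (x α : ZFSet.{0}) : Prop :=
  IsLimitOrd α ∧ ZFSet.omega ∈ α ∧
  ¬ ∃ δ, δ ∈ α ∧ ∃ f : ZFSet.{0} → ZFSet.{0},
      Sigma1DefOver (LstageA x.toSet α).toSet f ∧
      (∀ β, β ∈ δ → f β ∈ α) ∧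
      ∀ ξ, ξ ∈ α → ∃ β, β ∈ δ ∧ (ξ ∈ f β ∨ ξ = f β)

/-- The generalized Harrington Principle `HP(M)` for the inner model given by
the class `W`: there is a real `x` such that every `x`-admissible ordinal is a
cardinal of `W`. -/
def HPclass (W : Set ZFSet.{0}) : Prop :=
  ∃ x : ZFSet.{0}, x ⊆ ZFSet.omega ∧ ∀ α, Admissible x α → CardIn W α

/-- Harrington's Principle `HP(L)`. -/
def HPL : Prop := HPclass LClass

/-- `HP(L)` as computed inside the (transitive) model `W`. -/
def HPLIn (W : Set ZFSet.{0}) : Prop :=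
  ∃ x, x ∈ W ∧ x ⊆ ZFSet.omega ∧
    ∀ α, α ∈ W → Admissible x α → CardIn (LClassIn W) α

/-! ### Inner models, elementary embeddings, rigidity, covering -/

/-- `W` is an inner model: a transitive proper class containing all ordinals
and satisfying ZFC. -/
def InnerModelClass (W : Set ZFSet.{0}) : Prop :=
  (∀ x, x ∈ W → x.toSet ⊆ W) ∧ (∀ α : ZFSet.{0}, IsOrd α → α ∈ W) ∧ ModelsZFC W

/-- `j` is an elementary embedding of the class `(W, ∈)` into itself. -/
def ElemEmbOn (W : Set ZFSet.{0}) (j : ZFSet.{0} → ZFSet.{0}) : Prop :=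
  Set.MapsTo j W W ∧
  ∀ (n : ℕ) (φ : Fml n) (v : Fin n → ZFSet.{0}),
    (∀ i, v i ∈ W) → (Sat W φ v ↔ Sat W φ (j ∘ v))

/-- `W` has the rigidity property: there is no nontrivial elementary embedding
from `W` to `W`. -/
def RigidClass (W : Set ZFSet.{0}) : Prop :=
  ¬ ∃ j : ZFSet.{0} → ZFSet.{0}, ElemEmbOn W j ∧ ∃ x, x ∈ W ∧ j x ≠ x

/-- `W` has the full covering property: every set `X` of ordinals is covered
by some `Y ∈ W` with `|Y| = |X| + ω₁`. -/
def FullCovering (W : Set ZFSet.{0}) : Prop :=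
  ∀ X : ZFSet.{0}, (∀ z ∈ X, IsOrd z) →
    ∃ Y, Y ∈ W ∧ X ⊆ Y ∧ Nonempty (Y.toSet ≃ (X.toSet ⊕ (Aleph 1).toSet))

/-- The restriction `M|θ` of the inner model `W`: its elements of rank `< θ`. -/
def restrictTo (W : Set ZFSet.{0}) (θ : ZFSet.{0}) : Set ZFSet.{0} :=
  {x | x ∈ W ∧ rankZ x ∈ θ}

/-- The class `S` is definable (with parameters) in `H_θ`. -/
def DefinableInH (θ : ZFSet.{0}) (S : Set ZFSet.{0}) : Prop :=
  ∃ (n : ℕ) (φ : Fml (n + 1)) (v : Fin n → ZFSet.{0}),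
    (∀ i, v i ∈ Hset θ) ∧ ∀ x, x ∈ Hset θ → (x ∈ S ↔ Sat (Hset θ) φ (Fin.cons x v))

/-- `ν` is weakly inaccessible in `W`: a regular limit cardinal of `W`. -/
def WeaklyInaccIn (W : Set ZFSet.{0}) (ν : ZFSet.{0}) : Prop :=
  RegularIn W ν ∧ ZFSet.omega ∈ ν ∧
    ∀ β, β ∈ ν → ∃ δ, δ ∈ ν ∧ β ∈ δ ∧ CardIn W δ

/-! ### Measures, `κ`-models and `0†` -/

/-- `⟨L[U], ∈, U⟩ ⊨ "U is a normal ultrafilter over κ"`:  `L[U]` is a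
`κ`-model. -/
def IsKappaModel (κ U : ZFSet.{0}) : Prop :=
  IsOrd κ ∧ ZFSet.omega ∈ κ ∧ U ∈ LrelClass U ∧
  (∀ X, X ∈ U → X ⊆ κ ∧ X ∈ LrelClass U) ∧ κ ∈ U ∧ (∅ : ZFSet.{0}) ∉ U ∧
  (∀ X Y, X ∈ U → Y ∈ U → X ∩ Y ∈ U) ∧
  (∀ X Y, X ∈ U → Y ∈ LrelClass U → X ⊆ Y → Y ⊆ κ → Y ∈ U) ∧
  (∀ X, X ∈ LrelClass U → X ⊆ κ → (X ∈ U ∨ κ \ X ∈ U)) ∧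
  (∀ α, α ∈ κ → (insert α ∅ : ZFSet.{0}) ∉ U) ∧
  (∀ δ g, δ ∈ κ → g ∈ LrelClass U → ZFSet.IsFunc δ (ZFSet.powerset κ) g →
    (∀ ξ y, ZFSet.pair ξ y ∈ g → y ∈ U) →
    ZFSet.sep (fun β => ∀ ξ, ξ ∈ δ → ∀ y, ZFSet.pair ξ y ∈ g → β ∈ y) κ ∈ U) ∧
  (∀ f X, f ∈ LrelClass U → X ∈ U → ZFSet.IsFunc κ κ f →
    (∀ α, α ∈ X → α ≠ ∅ → ∀ y, ZFSet.pair α y ∈ f → y ∈ α) →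
    ∃ β Y, β ∈ κ ∧ Y ∈ U ∧ ∀ α, α ∈ Y → ZFSet.pair α β ∈ f)

/-- `0†` exists: there is a `κ`-model (for some `κ`) and a nontrivial
elementary embedding from that model to itself with critical point
greater than `κ`. -/
def ZeroDaggerExists : Prop :=
  ∃ κ U : ZFSet.{0}, IsKappaModel κ U ∧
    ∃ j : ZFSet.{0} → ZFSet.{0}, ElemEmbOn (LrelClass U) j ∧
      ∃ η, IsOrd η ∧ κ ∈ η ∧ (∀ β, β ∈ η → j β = β) ∧ j η ≠ η

/-- `U` witnesses that `κ` is a measurable cardinal (in `V`): `U` is a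
`κ`-complete nonprincipal normal ultrafilter on `κ`. -/
def IsMeasureOn (κ U : ZFSet.{0}) : Prop :=
  IsOrd κ ∧ ZFSet.omega ∈ κ ∧
  (∀ X, X ∈ U → X ⊆ κ) ∧ κ ∈ U ∧ (∅ : ZFSet.{0}) ∉ U ∧
  (∀ X Y, X ∈ U → Y ∈ U → X ∩ Y ∈ U) ∧
  (∀ X Y, X ∈ U → X ⊆ Y → Y ⊆ κ → Y ∈ U) ∧
  (∀ X : ZFSet.{0}, X ⊆ κ → (X ∈ U ∨ κ \ X ∈ U)) ∧
  (∀ α, α ∈ κ → (insert α ∅ : ZFSet.{0}) ∉ U) ∧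
  (∀ x : ZFSet.{0}, x.toSet ⊆ U.toSet → CardLT x κ → x ≠ ∅ →
    ZFSet.sep (fun β => ∀ y, y ∈ x → β ∈ y) κ ∈ U) ∧
  (∀ f X, X ∈ U → ZFSet.IsFunc κ κ f →
    (∀ α, α ∈ X → α ≠ ∅ → ∀ y, ZFSet.pair α y ∈ f → y ∈ α) →
    ∃ β Y, β ∈ κ ∧ Y ∈ U ∧ ∀ α, α ∈ Y → ZFSet.pair α β ∈ f)

/-- `κ` is a measurable cardinal. -/
def IsMeasurable (κ : ZFSet.{0}) : Prop := ∃ U, IsMeasureOn κ U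

/-- `U ∈ W` witnesses measurability of `κ` inside the inner model `W`. -/
def MeasurableIn (W : Set ZFSet.{0}) (κ U : ZFSet.{0}) : Prop :=
  U ∈ W ∧ IsOrd κ ∧ ZFSet.omega ∈ κ ∧
  (∀ X, X ∈ U → X ⊆ κ) ∧ κ ∈ U ∧ (∅ : ZFSet.{0}) ∉ U ∧
  (∀ X Y, X ∈ U → Y ∈ U → X ∩ Y ∈ U) ∧
  (∀ X Y, X ∈ U → Y ∈ W → X ⊆ Y → Y ⊆ κ → Y ∈ U) ∧
  (∀ X, X ∈ W → X ⊆ κ → (X ∈ U ∨ κ \ X ∈ U)) ∧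
  (∀ α, α ∈ κ → (insert α ∅ : ZFSet.{0}) ∉ U) ∧
  (∀ δ g, δ ∈ κ → g ∈ W → ZFSet.IsFunc δ (ZFSet.powerset κ) g →
    (∀ ξ y, ZFSet.pair ξ y ∈ g → y ∈ U) →
    ZFSet.sep (fun β => ∀ ξ, ξ ∈ δ → ∀ y, ZFSet.pair ξ y ∈ g → β ∈ y) κ ∈ U)

/-- There is an inner model with a measurable cardinal. -/
def ExistsInnerModelMeasurable : Prop :=
  ∃ W : Set ZFSet.{0}, InnerModelClass W ∧ ∃ κ U, MeasurableIn W κ U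

/-! ### Core-model-like inner models -/

/-- `W` satisfies the GCH. -/
def GCHIn (W : Set ZFSet.{0}) : Prop :=
  ∀ κ, CardIn W κ → (ZFSet.omega ∈ κ ∨ ZFSet.omega = κ) →
    ∃ f, f ∈ W ∧ IsInjF (ZFSet.sep (fun z => z ∈ W) (ZFSet.powerset κ))
      (SuccCardIn W κ) f

/-- `W` has the condensation property: the transitive collapse of any
elementary submodel of an initial segment of `W` is again an initial segment
of `W`. -/
def CondensationFor (W : Set ZFSet.{0}) : Prop :=
  ∀ θ : ZFSet.{0}, IsOrd θ → ∀ X : ZFSet.{0},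
    X.toSet ⊆ restrictTo W θ → ElemSub X (restrictTo W θ) →
    ∃ θ', IsOrd θ' ∧ (collapseSet X).toSet = restrictTo W θ'

/-- The properties of the Dodd–Jensen core model `K` (below a measurable
cardinal) which are relevant here: `K` is an inner model satisfying the GCH,
with condensation, and (by Dodd–Jensen, given that there is no inner model
with a measurable) the rigidity property. -/
def CoreModelProps (W : Set ZFSet.{0}) : Prop :=
  InnerModelClass W ∧ GCHIn W ∧ CondensationFor W ∧ RigidClass W

/-! ### `L(ℝ)`, determinacy, and `HOD` -/

/-- The base of the `L(ℝ)` hierarchy: the transitive closure of `{𝒫(ω)}`. -/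
def lrBase : ZFSet.{0} :=
  insert (ZFSet.powerset ZFSet.omega) (tcl (ZFSet.powerset ZFSet.omega))

/-- The hierarchy `L_α(ℝ)`. -/
def LRstage : ZFSet.{0} → ZFSet.{0} :=
  ZFSet.mem_wf.fix (C := fun _ => ZFSet.{0}) fun α ih =>
    lrBase ∪ ZFSet.sUnion
      (img (fun β => if h : β ∈ α then DefSetA ∅ (ih β h) else ∅) α)

/-- The class `L(ℝ)`. -/
def LRClass : Set ZFSet.{0} := {x | ∃ α, IsOrd α ∧ x ∈ LRstage α}

/-- The `ZFSet` coding the function `ω → ω` given by `g`. -/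
def seqCode (g : ℕ → ℕ) : ZFSet.{0} :=
  img (fun m => ZFSet.pair m (natZ (g (zfToNat m)))) ZFSet.omega

/-- The game on `ω` with payoff `A` (a set of coded functions `ω → ω`) is
determined: one of the two players has a winning strategy. -/
def DeterminedZ (A : ZFSet.{0}) : Prop :=
  (∃ σ : List ℕ → ℕ, ∀ g : ℕ → ℕ,
    (∀ n : ℕ, g (2 * n) = σ (List.ofFn (fun i : Fin (2 * n) => g i.val))) →
    seqCode g ∈ A) ∨
  (∃ τ : List ℕ → ℕ, ∀ g : ℕ → ℕ,
    (∀ n : ℕ, g (2 * n + 1) = τ (List.ofFn (fun i : Fin (2 * n + 1) => g i.val))) →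
    seqCode g ∉ A)

/-- `AD^{L(ℝ)}`: every set of reals in `L(ℝ)` is determined.  (Since every
real, and every strategy, belongs to `L(ℝ)`, this is equivalent to `L(ℝ) ⊨ AD`.) -/
def ADinLR : Prop :=
  ∀ A, A ∈ LRClass → (∀ f, f ∈ A → ZFSet.IsFunc ZFSet.omega ZFSet.omega f) →
    DeterminedZ A

/-- `x` is ordinal definable. -/
def IsOD (x : ZFSet.{0}) : Prop :=
  ∃ (n : ℕ) (φ : Fml (n + 1)) (v : Fin n → ZFSet.{0}),
    (∀ i, IsOrd (v i)) ∧ ∀ y, (Sat Set.univ φ (Fin.cons y v) ↔ y = x)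

/-- The class `HOD` of hereditarily ordinal definable sets. -/
def HODClass : Set ZFSet.{0} :=
  {x | IsOD x ∧ ∀ y, y ∈ tcl x → IsOD y}

/-- The class `L[A]` as computed inside the (transitive) model `W`. -/
def LrelClassIn (W : Set ZFSet.{0}) (A : ZFSet.{0}) : Set ZFSet.{0} :=
  {x | ∃ α, IsOrd α ∧ α ∈ W ∧ x ∈ LstageA A.toSet α}

/-! ### Basic facts on sets -/

@[simp] lemma mem_toSet {x y : ZFSet.{0}} : x ∈ y.toSet ↔ x ∈ y := Iff.rfl

@[simp] lemma mem_img {f : ZFSet.{0} → ZFSet.{0}} {x y : ZFSet.{0}} :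
    y ∈ img f x ↔ ∃ z ∈ x, f z = y := by
  unfold img
  exact @ZFSet.mem_image f (Classical.allZFSetDefinable _) x y

lemma mem_collapse {X y z : ZFSet.{0}} :
    z ∈ collapse X y ↔ ∃ w ∈ y, w ∈ X ∧ collapse X w = z := by
  conv_lhs => rw [collapse, WellFounded.fix_eq]
  rw [mem_img]
  constructor
  · rintro ⟨w, hw, rfl⟩
    rw [ZFSet.mem_sep] at hw
    refine ⟨w, hw.1, hw.2, ?_⟩
    rw [dif_pos hw.1]; rfl
  · rintro ⟨w, hw, hX, rfl⟩
    refine ⟨w, ZFSet.mem_sep.2 ⟨hw, hX⟩, ?_⟩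
    rw [dif_pos hw]; rfl

lemma mem_LstageA {A : Set ZFSet.{0}} {α z : ZFSet.{0}} :
    z ∈ LstageA A α ↔ ∃ β ∈ α, z ∈ DefSetA A (LstageA A β) := by
  conv_lhs => rw [LstageA, WellFounded.fix_eq]
  rw [ZFSet.mem_sUnion]
  constructor
  · rintro ⟨w, hw, hz⟩
    obtain ⟨β, hβ, rfl⟩ := mem_img.1 hw
    rw [dif_pos hβ] at hz
    exact ⟨β, hβ, hz⟩
  · rintro ⟨β, hβ, hz⟩
    refine ⟨_, mem_img.2 ⟨β, hβ, rfl⟩, ?_⟩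
    rw [dif_pos hβ]; exact hz

/-- The subset of `X` defined by `φ` with parameters `v`. -/
def defSub (X : ZFSet.{0}) {n : ℕ} (φ : Fml (n + 1)) (v : Fin n → ZFSet.{0}) : ZFSet.{0} :=
  ZFSet.sep (fun z => SatAB X.toSet ∅ ∅ φ (Fin.cons z v)) X

lemma mem_defSub {X : ZFSet.{0}} {n : ℕ} {φ : Fml (n + 1)} {v : Fin n → ZFSet.{0}}
    {z : ZFSet.{0}} :
    z ∈ defSub X φ v ↔ z ∈ X ∧ SatAB X.toSet ∅ ∅ φ (Fin.cons z v) := ZFSet.mem_sep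

lemma mem_DefSetA {X B : ZFSet.{0}} : B ∈ DefSetA ∅ X ↔
    ∃ (n : ℕ) (φ : Fml (n + 1)) (v : Fin n → ZFSet.{0}), (∀ i, v i ∈ X) ∧ B = defSub X φ v := by
  unfold DefSetA
  rw [ZFSet.mem_sep]
  constructor
  · exact fun h => h.2
  · rintro ⟨n, φ, v, hv, rfl⟩
    exact ⟨ZFSet.mem_powerset.2 fun z hz => (mem_defSub.1 hz).1, n, φ, v, hv, rfl⟩

lemma mem_Lstage {α z : ZFSet.{0}} :
    z ∈ Lstage α ↔ ∃ β ∈ α, z ∈ DefSetA ∅ (Lstage β) := mem_LstageA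

lemma subset_of_mem_DefSetA {X B : ZFSet.{0}} (h : B ∈ DefSetA ∅ X) : B ⊆ X := by
  obtain ⟨n, φ, v, hv, rfl⟩ := mem_DefSetA.1 h
  exact fun z hz => (mem_defSub.1 hz).1

lemma exists_mem_iff_of_countable {A : Set ZFSet.{0}} (h : A.Countable) :
    ∃ x : ZFSet.{0}, ∀ z, z ∈ x ↔ z ∈ A := by
  have : Countable A := h.to_subtype
  exact ⟨ZFSet.range (Subtype.val : A → ZFSet.{0}), fun z => by simp⟩

lemma Ctbl.mono {x y : ZFSet.{0}} (h : y ⊆ x) (hx : Ctbl x) : Ctbl y :=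
  Set.Countable.mono (fun _ hz => h hz) hx

lemma IsOrd.isOrdinal {x : ZFSet.{0}} (h : IsOrd x) : x.IsOrdinal :=
  ZFSet.isOrdinal_iff_forall_mem_isTransitive.2 h

lemma isOrd_iff {x : ZFSet.{0}} : IsOrd x ↔ x.IsOrdinal :=
  ZFSet.isOrdinal_iff_forall_mem_isTransitive.symm

lemma IsOrd.mem {x y : ZFSet.{0}} (h : IsOrd x) (hy : y ∈ x) : IsOrd y :=
  isOrd_iff.2 (h.isOrdinal.mem hy)

/-! ### Natural numbers -/

lemma natZ_eq : ∀ n : ℕ, natZ n = (n : Ordinal.{0}).toZFSet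
  | 0 => by simp [natZ]
  | n + 1 => by
    rw [natZ, natZ_eq n, Nat.cast_add_one, Ordinal.toZFSet_add_one]

lemma natZ_injective : Function.Injective natZ := by
  intro a b h
  rw [natZ_eq, natZ_eq] at h
  exact_mod_cast Ordinal.toZFSet_injective h

lemma zfToNat_natZ (n : ℕ) : zfToNat (natZ n) = n := by
  have h : ∃ m : ℕ, natZ m = natZ n := ⟨n, rfl⟩
  rw [zfToNat, dif_pos h]
  exact natZ_injective h.choose_spec

lemma mk_ofNat (n : ℕ) : ZFSet.mk (PSet.ofNat n) = natZ n := by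
  induction n with
  | zero => rfl
  | succ n ih => rw [natZ, ← ih]; rfl

lemma mem_omega {x : ZFSet.{0}} : x ∈ ZFSet.omega ↔ ∃ n, x = natZ n := by
  constructor
  · induction x using Quotient.inductionOn with
    | _ x =>
      rintro ⟨⟨n⟩, h⟩
      exact ⟨n, (ZFSet.sound h).trans (mk_ofNat n)⟩
  · rintro ⟨n, rfl⟩
    induction n with
    | zero => exact ZFSet.omega_zero
    | succ n ih => exact ZFSet.omega_succ ih

lemma omega_eq : (ZFSet.omega : ZFSet.{0}) = Ordinal.omega0.toZFSet := by
  ext x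
  rw [mem_omega, Ordinal.mem_toZFSet_iff]
  constructor
  · rintro ⟨n, rfl⟩
    exact ⟨n, Ordinal.natCast_lt_omega0 n, (natZ_eq n).symm⟩
  · rintro ⟨a, ha, rfl⟩
    obtain ⟨n, rfl⟩ := Ordinal.lt_omega0.1 ha
    exact ⟨n, (natZ_eq n).symm⟩

lemma mem_seqUnion {f : ℕ → ZFSet.{0}} {z : ZFSet.{0}} : z ∈ seqUnion f ↔ ∃ n, z ∈ f n := by
  unfold seqUnion
  rw [ZFSet.mem_sUnion]
  constructor
  · rintro ⟨w, hw, hz⟩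
    obtain ⟨m, hm, rfl⟩ := mem_img.1 hw
    exact ⟨_, hz⟩
  · rintro ⟨n, hz⟩
    refine ⟨f n, mem_img.2 ⟨natZ n, mem_omega.2 ⟨n, rfl⟩, ?_⟩, hz⟩
    rw [zfToNat_natZ]

/-! ### Hulls under countably many finitary operations -/

section Hull

variable {ι : Type} {Z : Type*}

/-- The closure of `A` under the finitary operations `f i`. -/
inductive Hull (f : ι → List Z → Z) (A : Set Z) : Z → Prop
  | base {z : Z} : z ∈ A → Hull f A z
  | op (i : ι) (l : List Z) : (∀ z ∈ l, Hull f A z) → Hull f A (f i l)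

lemma Hull.mono {f : ι → List Z → Z} {A B : Set Z} (h : A ⊆ B) {z : Z} (hz : Hull f A z) :
    Hull f B z := by
  induction hz with
  | base hz => exact .base (h hz)
  | op i l _ ih => exact .op i l ih

lemma countable_lists {A : Set Z} (hA : A.Countable) : {l : List Z | ∀ z ∈ l, z ∈ A}.Countable := by
  have : Countable A := hA.to_subtype
  refine (Set.countable_range (fun l : List A => l.map Subtype.val)).mono ?_
  intro l hl
  exact ⟨l.attach.map fun z => ⟨z.1, hl z.1 z.2⟩, by simp⟩

lemma Hull.countable [Countable ι] (f : ι → List Z → Z) {A : Set Z} (hA : A.Countable) :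
    {z | Hull f A z}.Countable := by
  let S : ℕ → Set Z := fun n => Nat.rec A
    (fun _ B => B ∪ ⋃ i, f i '' {l : List Z | ∀ z ∈ l, z ∈ B}) n
  have hS : ∀ n, (S n).Countable := by
    intro n
    induction n with
    | zero => exact hA
    | succ n ih =>
      exact ih.union (Set.countable_iUnion fun i => (countable_lists ih).image _)
  have hmono : Monotone S := monotone_nat_of_le_succ fun n => Set.subset_union_left
  refine (Set.countable_iUnion hS).mono ?_
  intro z hz
  induction hz with
  | base hz => exact Set.mem_iUnion.2 ⟨0, hz⟩
  | op i l _ ih =>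
    have : ∃ n, ∀ z ∈ l, z ∈ S n := by
      clear * - ih hmono
      induction l with
      | nil => exact ⟨0, by simp⟩
      | cons a l ihl =>
        obtain ⟨n, hn⟩ := ihl fun z hz => ih z (List.mem_cons_of_mem _ hz)
        obtain ⟨m, hm⟩ := Set.mem_iUnion.1 (ih a List.mem_cons_self)
        refine ⟨max n m, fun z hz => ?_⟩
        rcases List.mem_cons.1 hz with rfl | hz
        · exact hmono (le_max_right _ _) hm
        · exact hmono (le_max_left _ _) (hn z hz)
    obtain ⟨n, hn⟩ := this
    exact Set.mem_iUnion.2 ⟨n + 1, Or.inr (Set.mem_iUnion.2 ⟨i, l, hn, rfl⟩)⟩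

lemma Hull.exists_list {f : ι → List Z → Z} {A : Set Z} {z : Z} (hz : Hull f A z) :
    ∃ l : List Z, (∀ a ∈ l, a ∈ A) ∧ Hull f {a | a ∈ l} z := by
  induction hz with
  | @base z hz => exact ⟨[z], by simpa using hz, .base (by simp)⟩
  | op i l _ ih =>
    have : ∃ m : List Z, (∀ a ∈ m, a ∈ A) ∧ ∀ z ∈ l, Hull f {a | a ∈ m} z := by
      clear * - ih
      induction l with
      | nil => exact ⟨[], by simp, by simp⟩
      | cons a l ihl =>
        obtain ⟨m, hm, h⟩ := ihl fun z hz => ih z (List.mem_cons_of_mem _ hz)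
        obtain ⟨k, hk, h'⟩ := ih a List.mem_cons_self
        refine ⟨m ++ k, ?_, ?_⟩
        · intro b hb
          rcases List.mem_append.1 hb with hb | hb
          exacts [hm b hb, hk b hb]
        · intro z hz
          rcases List.mem_cons.1 hz with rfl | hz
          · exact h'.mono fun b hb => List.mem_append_right _ hb
          · exact (h z hz).mono fun b hb => List.mem_append_left _ hb
    obtain ⟨m, hm, h⟩ := this
    exact ⟨m, hm, .op i l h⟩

lemma exists_countable_closed [Countable ι] [Nonempty Z] (R : ι → List Z → Z → Prop) {A : Set Z}
    (hA : A.Countable) : ∃ M : Set Z, A ⊆ M ∧ M.Countable ∧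
      ∀ i l, (∀ z ∈ l, z ∈ M) → (∃ y, R i l y) → ∃ y ∈ M, R i l y := by
  let f : ι → List Z → Z := fun i l => Classical.epsilon (R i l)
  exact ⟨{z | Hull f A z}, fun z hz => .base hz, Hull.countable f hA,
    fun i l hl h => ⟨f i l, .op i l hl, Classical.epsilon_spec h⟩⟩

end Hull

/-! ### Countability of the set of formulas, elementarity -/

lemma codeF_injective : ∀ {n : ℕ}, Function.Injective (codeF : Fml n → ℕ) := by
  intro n φ
  induction φ with
  | mem i j => intro ψ h; cases ψ <;> simp_all [codeF, Nat.pair_eq_pair, Fin.ext_iff]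
  | eq i j => intro ψ h; cases ψ <;> simp_all [codeF, Nat.pair_eq_pair, Fin.ext_iff]
  | inA i => intro ψ h; cases ψ <;> simp_all [codeF, Nat.pair_eq_pair, Fin.ext_iff]
  | inB i => intro ψ h; cases ψ <;> simp_all [codeF, Nat.pair_eq_pair, Fin.ext_iff]
  | not φ ih =>
    intro ψ h
    cases ψ <;> simp only [codeF, Nat.pair_eq_pair] at h <;> first | omega | skip
    rw [ih h.2]
  | and φ χ ih ih' =>
    intro ψ h
    cases ψ <;> simp only [codeF, Nat.pair_eq_pair] at h <;> first | omega | skip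
    rw [ih h.2.1, ih' h.2.2]
  | ex φ ih =>
    intro ψ h
    cases ψ <;> simp only [codeF, Nat.pair_eq_pair] at h <;> first | omega | skip
    rw [ih h.2]

instance (n : ℕ) : Countable (Fml n) := codeF_injective.countable

/-- The Tarski–Vaught criterion. -/
lemma sat_iff_of_witness {M S : Set ZFSet.{0}} (hMS : M ⊆ S)
    (h : ∀ (n : ℕ) (φ : Fml (n + 1)) (v : Fin n → ZFSet.{0}), (∀ i, v i ∈ M) →
      (∃ x ∈ S, SatAB S ∅ ∅ φ (Fin.cons x v)) → ∃ x ∈ M, SatAB S ∅ ∅ φ (Fin.cons x v)) :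
    ∀ {n : ℕ} (φ : Fml n) (v : Fin n → ZFSet.{0}), (∀ i, v i ∈ M) →
      (SatAB M ∅ ∅ φ v ↔ SatAB S ∅ ∅ φ v) := by
  intro n φ
  induction φ with
  | mem i j => intro v _; rfl
  | eq i j => intro v _; rfl
  | inA i => intro v _; rfl
  | inB i => intro v _; rfl
  | not φ ih => intro v hv; exact not_congr (ih v hv)
  | and φ ψ ih ih' => intro v hv; exact and_congr (ih v hv) (ih' v hv)
  | ex φ ih =>
    intro v hv
    constructor
    · rintro ⟨x, hx, hs⟩
      exact ⟨x, hMS hx, (ih _ (Fin.cases hx hv)).1 hs⟩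
    · intro hs
      obtain ⟨x, hx, hs⟩ := h _ φ v hv hs
      exact ⟨x, hx, (ih _ (Fin.cases hx hv)).2 hs⟩

/-! ### Cardinality and `H_κ` -/

lemma cardLE_iff {x y : ZFSet.{0}} : CardLE x y ↔ x.card ≤ y.card := by
  rw [← Cardinal.lift_le.{1}, ← ZFSet.cardinalMk_coe_sort, ← ZFSet.cardinalMk_coe_sort,
    Cardinal.le_def]
  rfl

lemma eqNum_iff {x y : ZFSet.{0}} : EqNum x y ↔ x.card = y.card := by
  rw [← Cardinal.lift_inj.{0, 1}, ← ZFSet.cardinalMk_coe_sort, ← ZFSet.cardinalMk_coe_sort,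
    Cardinal.eq]
  rfl

lemma ctbl_iff {x : ZFSet.{0}} : Ctbl x ↔ x.card ≤ Cardinal.aleph0 := by
  rw [← Cardinal.lift_le.{1}, ← ZFSet.cardinalMk_coe_sort, Cardinal.lift_aleph0,
    Cardinal.mk_le_aleph0_iff]
  rfl

lemma IsCard.card_lt {κ α : ZFSet.{0}} (hκ : IsCard κ) (hα : α ∈ κ) : α.card < κ.card :=
  lt_of_le_of_ne (ZFSet.card_mono (hκ.1.1 α hα)) fun h => hκ.2 α hα (eqNum_iff.2 h)

lemma IsCard.cardLT_iff {κ x : ZFSet.{0}} (hκ : IsCard κ) : CardLT x κ ↔ x.card < κ.card := by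
  constructor
  · rintro ⟨α, hα, h⟩
    exact (cardLE_iff.1 h).trans_lt (hκ.card_lt hα)
  · intro h
    have e := hκ.1.isOrdinal.toZFSet_rank_eq
    refine ⟨x.card.ord.toZFSet, ?_, cardLE_iff.2 (by simp)⟩
    rw [← e, Ordinal.toZFSet_mem_toZFSet_iff]
    by_contra hle
    have := Ordinal.card_le_card (not_lt.1 hle)
    rw [Cardinal.card_ord, ← Ordinal.card_toZFSet, e] at this
    exact absurd h (not_lt.2 this)

lemma card_omega : (ZFSet.omega : ZFSet.{0}).card = Cardinal.aleph0 := by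
  rw [omega_eq, Ordinal.card_toZFSet, Ordinal.card_omega0]

lemma card_iUnion_le {x : ZFSet.{0}} (t : x → ZFSet.{0}) {c : Cardinal.{0}}
    (h : ∀ i, (t i).card ≤ c) : (ZFSet.iUnion t).card ≤ x.card * c := by
  rw [← Cardinal.lift_le.{1}]
  refine ZFSet.lift_card_iUnion_le_sum_card.trans ?_
  refine (Cardinal.sum_le_sum _ (fun _ => c) h).trans ?_
  rw [Cardinal.sum_const, Cardinal.lift_mul, ZFSet.cardinalMk_coe_sort, Cardinal.lift_lift]

section

variable {κ : ZFSet.{0}}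

lemma Hset.trans {x y : ZFSet.{0}} (hx : x ∈ Hset κ) (hy : y ∈ x) : y ∈ Hset κ := by
  obtain ⟨t, ht, hxt, hc⟩ := hx
  exact ⟨t, ht, ht x hxt hy, hc⟩

lemma exists_bound (hκ : IsRegular κ) {x : ZFSet.{0}} (hx : x.card < κ.card)
    (a : x → ZFSet.{0}) (ha : ∀ i, a i ∈ κ) : ∃ β ∈ κ, ∀ i, a i ⊆ β := by
  have h1 : ¬ UnbIn (ZFSet.range a) κ := by
    intro h
    have h2 := hκ.2 (ZFSet.range a) (by
      intro z hz
      obtain ⟨i, rfl⟩ := ZFSet.mem_range.1 hz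
      exact ha i) h
    have h3 := ZFSet.lift_card_range_le (f := a)
    rw [ZFSet.cardinalMk_coe_sort, Cardinal.lift_lift, Cardinal.lift_le, eqNum_iff.1 h2] at h3
    exact absurd hx (not_lt.2 h3)
  simp only [UnbIn, not_forall] at h1
  obtain ⟨β, hβ, h⟩ := h1
  refine ⟨β, hβ, fun i => ?_⟩
  have oβ := (hκ.1.1.mem hβ).isOrdinal
  have oa := (hκ.1.1.mem (ha i)).isOrdinal
  push Not at h
  have := h (a i) (ZFSet.mem_range_self i)
  rcases oβ.mem_trichotomous oa with h | h | h
  · exact absurd h this.1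
  · exact absurd h this.2
  · exact oβ.subset_of_mem h

lemma aleph0_lt (hκ : IsRegular κ) (hω : ZFSet.omega ∈ κ) : Cardinal.aleph0 < κ.card :=
  card_omega ▸ hκ.1.card_lt hω

lemma Hset.mem_of_card_lt (hκ : IsRegular κ) (hω : ZFSet.omega ∈ κ) {x : ZFSet.{0}}
    (hx : ∀ z ∈ x, z ∈ Hset κ) (hc : x.card < κ.card) : x ∈ Hset κ := by
  have hx' : ∀ z : x, ∃ t : ZFSet.{0}, t.IsTransitive ∧ z.1 ∈ t ∧ CardLT t κ := fun z => hx z z.2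
  choose t ht hzt hct using hx'
  choose a ha hta using hct
  obtain ⟨β, hβ, hb⟩ := exists_bound hκ hc a ha
  have h0 := aleph0_lt hκ hω
  refine ⟨insert x (ZFSet.iUnion t), ?_, ZFSet.mem_insert _ _, hκ.1.cardLT_iff.2 ?_⟩
  · intro y hy z hz
    refine ZFSet.mem_insert_of_mem _ ?_
    rcases ZFSet.mem_insert_iff.1 hy with rfl | hy
    · exact ZFSet.mem_iUnion.2 ⟨⟨z, hz⟩, hzt _⟩
    · obtain ⟨i, hi⟩ := ZFSet.mem_iUnion.1 hy
      exact ZFSet.mem_iUnion.2 ⟨i, ht i y hi hz⟩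
  · refine ZFSet.card_insert_le.trans_lt (Cardinal.add_lt_of_lt h0.le ?_ ?_)
    · refine (card_iUnion_le t (c := β.card) fun i => ?_).trans_lt
        (Cardinal.mul_lt_of_lt h0.le hc (hκ.1.card_lt hβ))
      exact (cardLE_iff.1 (hta i)).trans (ZFSet.card_mono (hb i))
    · exact Cardinal.one_lt_aleph0.trans h0

lemma Hset.mem_of_ctbl (hκ : IsRegular κ) (hω : ZFSet.omega ∈ κ) {x : ZFSet.{0}}
    (hx : ∀ z ∈ x, z ∈ Hset κ) (hc : Ctbl x) : x ∈ Hset κ :=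
  Hset.mem_of_card_lt hκ hω hx ((ctbl_iff.1 hc).trans_lt (aleph0_lt hκ hω))

lemma Hset.pair_set (hκ : IsRegular κ) (hω : ZFSet.omega ∈ κ) {x y : ZFSet.{0}}
    (hx : x ∈ Hset κ) (hy : y ∈ Hset κ) : ({x, y} : ZFSet.{0}) ∈ Hset κ := by
  refine Hset.mem_of_ctbl hκ hω ?_ ?_
  · intro z hz
    rcases ZFSet.mem_pair.1 hz with rfl | rfl <;> assumption
  · exact (Set.to_countable {x, y}).mono fun z hz => ZFSet.mem_pair.1 hz

lemma Hset.mem_of_mem (hκ : IsRegular κ) {α : ZFSet.{0}} (hα : α ∈ κ)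
    (hω : ZFSet.omega ∈ κ) : α ∈ Hset κ := by
  refine ⟨insert α α, ?_, ZFSet.mem_insert _ _, hκ.1.cardLT_iff.2 ?_⟩
  · exact (ZFSet.isOrdinal_succ (hκ.1.1.mem hα).isOrdinal).isTransitive
  · have h0 := aleph0_lt hκ hω
    exact ZFSet.card_insert_le.trans_lt
      (Cardinal.add_lt_of_lt h0.le (hκ.1.card_lt hα) (Cardinal.one_lt_aleph0.trans h0))

end

lemma isCard_ord (c : Cardinal.{0}) : IsCard c.ord.toZFSet := by
  refine ⟨isOrd_iff.2 (ZFSet.isOrdinal_toZFSet _), fun α hα h => ?_⟩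
  obtain ⟨a, ha, rfl⟩ := Ordinal.mem_toZFSet_iff.1 hα
  have := eqNum_iff.1 h
  rw [Ordinal.card_toZFSet, Ordinal.card_toZFSet, Cardinal.card_ord] at this
  exact (Cardinal.lt_ord.1 ha).ne this

lemma isRegular_succ {c : Cardinal.{0}} (hc : Cardinal.aleph0 ≤ c) :
    IsRegular (Order.succ c).ord.toZFSet := by
  have hK := isCard_ord (Order.succ c)
  set K := (Order.succ c).ord.toZFSet with hKdef
  have hcard : K.card = Order.succ c := by rw [hKdef, Ordinal.card_toZFSet, Cardinal.card_ord]
  refine ⟨hK, fun x hx hu => eqNum_iff.2 (le_antisymm (ZFSet.card_mono hx) ?_)⟩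
  rw [hcard, Order.succ_le_iff]
  by_contra hlt
  have hsub : K ⊆ ZFSet.iUnion (fun z : x => insert z.1 z.1) := by
    intro β hβ
    obtain ⟨z, hz, h⟩ := hu β hβ
    refine ZFSet.mem_iUnion.2 ⟨⟨z, hz⟩, ?_⟩
    rw [ZFSet.mem_insert_iff]
    exact h.symm
  have h1 := ZFSet.card_mono hsub
  have h2 := card_iUnion_le (fun z : x => insert z.1 z.1) (c := c) (fun i => by
    have := hK.card_lt (hx i.2)
    rw [hcard, Order.lt_succ_iff] at this
    exact ZFSet.card_insert_le.trans
      (Cardinal.add_le_of_le hc this (Cardinal.one_le_aleph0.trans hc)))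
  have h3 : K.card ≤ c := h1.trans (h2.trans
    ((mul_le_mul' (not_lt.1 hlt) le_rfl).trans (Cardinal.mul_eq_self hc).le))
  rw [hcard] at h3
  exact absurd (Order.lt_succ c) (not_lt.2 h3)

lemma exists_isRegular {γ : ZFSet.{0}} (hγ : IsOrd γ) : ∃ κ, IsRegular κ ∧ γ ∈ κ := by
  refine ⟨_, isRegular_succ (c := max Cardinal.aleph0 γ.card) (le_max_left _ _), ?_⟩
  rw [← hγ.isOrdinal.toZFSet_rank_eq, Ordinal.toZFSet_mem_toZFSet_iff, Cardinal.lt_ord,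
    Ordinal.card_toZFSet, Order.lt_succ_iff]
  rw [← Ordinal.card_toZFSet, hγ.isOrdinal.toZFSet_rank_eq]
  exact le_max_right _ _

lemma omega_mem_Aleph_one : ZFSet.omega ∈ Aleph 1 := by
  have hex : ∃ α : ZFSet.{0}, IsOrd α ∧ IsCard α ∧ ZFSet.omega ∈ α := by
    obtain ⟨κ, hκ, h⟩ := exists_isRegular (γ := ZFSet.omega)
      (isOrd_iff.2 (omega_eq ▸ ZFSet.isOrdinal_toZFSet _))
    exact ⟨κ, hκ.1.1, hκ.1, h⟩
  obtain ⟨α, hα, hmin⟩ := ZFSet.mem_wf.has_min {α | IsOrd α ∧ IsCard α ∧ ZFSet.omega ∈ α} hex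
  have h : ∃ α, (IsOrd α ∧ IsCard α ∧ Aleph 0 ∈ α) ∧
      ∀ β ∈ α, ¬ (IsOrd β ∧ IsCard β ∧ Aleph 0 ∈ β) :=
    ⟨α, hα, fun β hβ h => hmin β h hβ⟩
  rw [Aleph, leastOrd, dif_pos h]
  exact h.choose_spec.1.2.2

/-! ### First-order definability over a transitive class closed under pairing -/

/-- `P` is first-order definable without parameters over `(S, ∈)`. -/
def Dfb (S : Set ZFSet.{0}) {n : ℕ} (P : (Fin n → ZFSet.{0}) → Prop) : Prop :=
  ∃ φ : Fml n, ∀ v, (∀ i, v i ∈ S) → (Sat S φ v ↔ P v)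

/-- `S` is a transitive class closed under unordered pairs. -/
structure PairClosed (S : Set ZFSet.{0}) : Prop where
  trans : ∀ {x y : ZFSet.{0}}, x ∈ S → y ∈ x → y ∈ S
  upair : ∀ {x y : ZFSet.{0}}, x ∈ S → y ∈ S → ({x, y} : ZFSet.{0}) ∈ S

section Definability

variable {S : Set ZFSet.{0}} {n : ℕ}

lemma PairClosed.pair (hS : PairClosed S) {x y : ZFSet.{0}} (hx : x ∈ S) (hy : y ∈ S) :
    ZFSet.pair x y ∈ S := by
  unfold ZFSet.pair
  refine hS.upair ?_ (hS.upair hx hy)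
  rw [← ZFSet.pair_eq_singleton]
  exact hS.upair hx hx

lemma PairClosed.of_pair (hS : PairClosed S) {x y : ZFSet.{0}} (h : ZFSet.pair x y ∈ S) :
    x ∈ S ∧ y ∈ S := by
  unfold ZFSet.pair at h
  have := hS.trans h (ZFSet.mem_pair.2 (Or.inr rfl))
  exact ⟨hS.trans this (ZFSet.mem_pair.2 (Or.inl rfl)),
    hS.trans this (ZFSet.mem_pair.2 (Or.inr rfl))⟩

namespace Dfb

variable {P Q : (Fin n → ZFSet.{0}) → Prop}

lemma congr (h : Dfb S P) (e : ∀ v, (∀ i, v i ∈ S) → (P v ↔ Q v)) : Dfb S Q := by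
  obtain ⟨φ, hφ⟩ := h
  exact ⟨φ, fun v hv => (hφ v hv).trans (e v hv)⟩

lemma mem (i j : Fin n) : Dfb S (fun v => v i ∈ v j) := ⟨.mem i j, fun _ _ => Iff.rfl⟩

lemma eq (i j : Fin n) : Dfb S (fun v => v i = v j) := ⟨.eq i j, fun _ _ => Iff.rfl⟩

lemma not (h : Dfb S P) : Dfb S (fun v => ¬ P v) := by
  obtain ⟨φ, hφ⟩ := h
  exact ⟨.not φ, fun v hv => not_congr (hφ v hv)⟩

lemma and (h : Dfb S P) (h' : Dfb S Q) : Dfb S (fun v => P v ∧ Q v) := by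
  obtain ⟨φ, hφ⟩ := h
  obtain ⟨ψ, hψ⟩ := h'
  exact ⟨.and φ ψ, fun v hv => and_congr (hφ v hv) (hψ v hv)⟩

lemma or (h : Dfb S P) (h' : Dfb S Q) : Dfb S (fun v => P v ∨ Q v) :=
  (h.not.and h'.not).not.congr fun _ _ => by tauto

lemma imp (h : Dfb S P) (h' : Dfb S Q) : Dfb S (fun v => P v → Q v) :=
  (h.and h'.not).not.congr fun _ _ => by tauto

lemma iff (h : Dfb S P) (h' : Dfb S Q) : Dfb S (fun v => P v ↔ Q v) :=
  ((h.imp h').and (h'.imp h)).congr fun _ _ => by tauto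

lemma ex {P : ZFSet.{0} → (Fin n → ZFSet.{0}) → Prop}
    (h : Dfb S (fun w : Fin (n + 1) → ZFSet.{0} => P (w 0) (fun i => w i.succ))) :
    Dfb S (fun v => ∃ x ∈ S, P x v) := by
  obtain ⟨φ, hφ⟩ := h
  refine ⟨.ex φ, fun v hv => exists_congr fun x => and_congr_right fun hx => ?_⟩
  exact hφ (Fin.cons x v) (Fin.cases hx hv)

lemma all {P : ZFSet.{0} → (Fin n → ZFSet.{0}) → Prop}
    (h : Dfb S (fun w : Fin (n + 1) → ZFSet.{0} => P (w 0) (fun i => w i.succ))) :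
    Dfb S (fun v => ∀ x ∈ S, P x v) :=
  (ex (P := fun x v => ¬ P x v) h.not).not.congr fun v _ => by push Not; rfl

lemma bex (hS : PairClosed S) (j : Fin n) {P : ZFSet.{0} → (Fin n → ZFSet.{0}) → Prop}
    (h : Dfb S (fun w : Fin (n + 1) → ZFSet.{0} => P (w 0) (fun i => w i.succ))) :
    Dfb S (fun v => ∃ x ∈ v j, P x v) :=
  (ex (P := fun x v => x ∈ v j ∧ P x v) ((mem 0 j.succ).and h)).congr fun _ hv =>
    ⟨fun ⟨x, _, hx⟩ => ⟨x, hx⟩, fun ⟨x, hx⟩ => ⟨x, hS.trans (hv j) hx.1, hx⟩⟩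

lemma ball (hS : PairClosed S) (j : Fin n) {P : ZFSet.{0} → (Fin n → ZFSet.{0}) → Prop}
    (h : Dfb S (fun w : Fin (n + 1) → ZFSet.{0} => P (w 0) (fun i => w i.succ))) :
    Dfb S (fun v => ∀ x ∈ v j, P x v) :=
  (bex hS j (P := fun x v => ¬ P x v) h.not).not.congr fun v _ => by push Not; rfl

lemma eq_empty (hS : PairClosed S) (i : Fin n) : Dfb S (fun v => v i = ∅) := by
  refine Dfb.congr (P := fun v => ∀ x ∈ v i, ¬ x = x) ?_ fun v _ => ?_
  · exact ball hS i (not (eq _ _))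
  · rw [ZFSet.eq_empty]; simp

lemma eq_upair (hS : PairClosed S) (k i j : Fin n) :
    Dfb S (fun v => v k = ({v i, v j} : ZFSet.{0})) := by
  refine Dfb.congr (P := fun v => v i ∈ v k ∧ v j ∈ v k ∧ ∀ x ∈ v k, x = v i ∨ x = v j)
    ?_ fun v _ => ?_
  · exact (mem _ _).and ((mem _ _).and (ball hS k ((eq _ _).or (eq _ _))))
  · constructor
    · rintro ⟨h1, h2, h3⟩
      ext z
      rw [ZFSet.mem_pair]
      refine ⟨h3 z, ?_⟩
      rintro (rfl | rfl) <;> assumption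
    · intro h; rw [h]; simp

lemma eq_pair (hS : PairClosed S) (k i j : Fin n) :
    Dfb S (fun v => v k = ZFSet.pair (v i) (v j)) := by
  refine Dfb.congr (P := fun v => ∃ p ∈ S, ∃ q ∈ S, p = ({v i, v i} : ZFSet.{0}) ∧
    q = ({v i, v j} : ZFSet.{0}) ∧ v k = ({p, q} : ZFSet.{0})) ?_ fun v hv => ?_
  · exact ex (ex ((eq_upair hS _ _ _).and ((eq_upair hS _ _ _).and (eq_upair hS _ _ _))))
  · constructor
    · rintro ⟨p, -, q, -, rfl, rfl, h⟩
      rw [h, ZFSet.pair_eq_singleton]; rfl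
    · intro h
      refine ⟨_, hS.upair (hv i) (hv i), _, hS.upair (hv i) (hv j), rfl, rfl, ?_⟩
      rw [h, ZFSet.pair_eq_singleton]; rfl

lemma pair_mem (hS : PairClosed S) (i j k : Fin n) :
    Dfb S (fun v => ZFSet.pair (v i) (v j) ∈ v k) :=
  Dfb.congr (P := fun v => ∃ q ∈ v k, q = ZFSet.pair (v i) (v j))
    (bex hS k (eq_pair hS _ _ _)) fun v _ => by simp

lemma eq_pair_pair (hS : PairClosed S) (k i j l : Fin n) :
    Dfb S (fun v => v k = ZFSet.pair (v i) (ZFSet.pair (v j) (v l))) := by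
  refine Dfb.congr (P := fun v => ∃ q ∈ S, q = ZFSet.pair (v j) (v l) ∧ v k = ZFSet.pair (v i) q)
    (ex ((eq_pair hS _ _ _).and (eq_pair hS _ _ _))) fun v hv => ?_
  constructor
  · rintro ⟨q, -, rfl, h⟩; exact h
  · exact fun h => ⟨_, hS.pair (hv j) (hv l), rfl, h⟩

lemma insert_mem (hS : PairClosed S) (i k : Fin n) :
    Dfb S (fun v => insert (v i) (v i) ∈ v k) := by
  refine Dfb.congr (P := fun v => ∃ q ∈ v k, v i ∈ q ∧ (∀ z ∈ q, z = v i ∨ z ∈ v i) ∧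
    ∀ z ∈ v i, z ∈ q) ?_ fun v _ => ?_
  · exact bex hS _ ((mem _ _).and ((ball hS _ ((eq _ _).or (mem _ _))).and (ball hS _ (mem _ _))))
  · constructor
    · rintro ⟨q, hq, h1, h2, h3⟩
      have : q = insert (v i) (v i) := by
        ext z
        rw [ZFSet.mem_insert_iff]
        refine ⟨h2 z, ?_⟩
        rintro (rfl | h)
        exacts [h1, h3 z h]
      exact this ▸ hq
    · intro h
      exact ⟨_, h, by simp, by simp, by simp +contextual⟩

lemma empty_mem (hS : PairClosed S) (k : Fin n) : Dfb S (fun v => (∅ : ZFSet.{0}) ∈ v k) :=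
  Dfb.congr (P := fun v => ∃ q ∈ v k, q = ∅) (bex hS k (eq_empty hS _)) fun v _ => by simp

lemma isOrd (hS : PairClosed S) (i : Fin n) : Dfb S (fun v => IsOrd (v i)) := by
  refine Dfb.congr (P := fun v => (∀ y ∈ v i, ∀ z ∈ y, z ∈ v i) ∧
    ∀ x ∈ v i, ∀ y ∈ x, ∀ z ∈ y, z ∈ x) ?_ fun v _ => Iff.rfl
  exact (ball hS _ (ball hS _ (mem _ _))).and (ball hS _ (ball hS _ (ball hS _ (mem _ _))))

lemma isSurjF (hS : PairClosed S) (i j k : Fin n) :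
    Dfb S (fun v => IsSurjF (v i) (v j) (v k)) := by
  refine Dfb.congr (P := fun v => (∀ p ∈ v k, ∃ a ∈ v i, ∃ b ∈ v j, p = ZFSet.pair a b) ∧
    (∀ a ∈ v i, ∃ b ∈ v j, ZFSet.pair a b ∈ v k ∧ ∀ c ∈ v j, ZFSet.pair a c ∈ v k → c = b) ∧
    ∀ y ∈ v j, ∃ x ∈ v i, ZFSet.pair x y ∈ v k) ?_ fun v _ => ?_
  · exact (ball hS _ (bex hS _ (bex hS _ (eq_pair hS _ _ _)))).and
      ((ball hS _ (bex hS _ ((pair_mem hS _ _ _).and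
        (ball hS _ ((pair_mem hS _ _ _).imp (eq _ _)))))).and
      (ball hS _ (bex hS _ (pair_mem hS _ _ _))))
  · have key : ∀ {a b}, (∀ p ∈ v k, ∃ a ∈ v i, ∃ b ∈ v j, p = ZFSet.pair a b) →
        ZFSet.pair a b ∈ v k → b ∈ v j := by
      intro a b h hab
      obtain ⟨a', -, b', hb', e⟩ := h _ hab
      rw [(ZFSet.pair_inj.1 e).2]; exact hb'
    have sub : v k ⊆ ZFSet.prod (v i) (v j) ↔
        ∀ p ∈ v k, ∃ a ∈ v i, ∃ b ∈ v j, p = ZFSet.pair a b :=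
      forall₂_congr fun p _ => ZFSet.mem_prod
    unfold IsSurjF ZFSet.IsFunc
    rw [sub, and_assoc]
    refine and_congr_right fun h => and_congr_left' (forall₂_congr fun a _ => ?_)
    constructor
    · rintro ⟨b, -, hb, hu⟩
      exact ⟨b, hb, fun c hc => hu c (key h hc) hc⟩
    · rintro ⟨b, hb, hu⟩
      exact ⟨b, key h hb, hb, fun c _ hc => hu c hc⟩

end Dfb

/-! ### Relativized notions used to define constructibility over `H_κ` -/

variable (S)

/-- `w` is the least inductive set, as seen in `S`. -/
def OmegaS (w : ZFSet.{0}) : Prop :=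
  (∅ ∈ w ∧ ∀ y ∈ w, insert y y ∈ w) ∧
    ∀ u ∈ S, (∅ ∈ u ∧ ∀ y ∈ u, insert y y ∈ u) → ∀ y ∈ w, y ∈ u

/-- `x` is countable, as seen in `S`. -/
def CtblS (x : ZFSet.{0}) : Prop :=
  ∃ c ∈ S, ∃ w ∈ S, OmegaS S w ∧ (∀ y ∈ x, ∃ m ∈ w, ZFSet.pair m y ∈ c) ∧
    ∀ m ∈ w, ∀ y ∈ x, ∀ z ∈ x, ZFSet.pair m y ∈ c → ZFSet.pair m z ∈ c → y = z

/-- The family `D` of relations on `A` (sets of finite sequences coded by iterated pairs) contains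
the basic relations and is closed under the operations generating all definable relations. -/
def ClosedFamS (A D : ZFSet.{0}) : Prop :=
  (∃ Q ∈ D, ∀ z ∈ S, z ∈ Q ↔ z = ∅) ∧ ∀ R ∈ D,
    (∀ T ∈ D, ∃ Q ∈ D, ∀ z ∈ S, z ∈ Q ↔ z ∈ R ∧ ¬ z ∈ T) ∧
    (∃ Q ∈ D, ∀ z ∈ S, z ∈ Q ↔ ∃ a ∈ A, ∃ s ∈ R, z = ZFSet.pair a s) ∧
    (∃ Q ∈ D, ∀ z ∈ S, z ∈ Q ↔ ∃ a ∈ A, ∃ b ∈ A, ∃ s ∈ S, ZFSet.pair a s ∈ R ∧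
      z = ZFSet.pair a (ZFSet.pair b s)) ∧
    (∃ Q ∈ D, ∀ z ∈ S, z ∈ Q ↔ ∃ a ∈ A, ∃ b ∈ A, ∃ s ∈ R, a ∈ b ∧
      z = ZFSet.pair a (ZFSet.pair b s)) ∧
    (∃ Q ∈ D, ∀ z ∈ S, z ∈ Q ↔ ∃ a ∈ A, ∃ b ∈ A, ∃ s ∈ R, b ∈ a ∧
      z = ZFSet.pair a (ZFSet.pair b s)) ∧
    (∃ Q ∈ D, ∀ z ∈ S, z ∈ Q ↔ ∃ a ∈ A, ∃ b ∈ A, ∃ s ∈ R, a = b ∧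
      z = ZFSet.pair a (ZFSet.pair b s)) ∧
    ∃ Q ∈ D, ∀ z ∈ S, z ∈ Q ↔ ∃ a ∈ A, ZFSet.pair a z ∈ R

/-- `B` is a definable subset of `A`, as seen in `S`. -/
def DefS (A B : ZFSet.{0}) : Prop :=
  ∀ D ∈ S, ClosedFamS S A D → ∃ R ∈ D, ∃ s ∈ S, ∀ z ∈ S, z ∈ B ↔ z ∈ A ∧ ZFSet.pair z s ∈ R

/-- `g` is an initial part of the constructible hierarchy, as seen in `S`. -/
def HierS (g : ZFSet.{0}) : Prop :=
  ∀ p ∈ g, ∃ ξ ∈ S, ∃ y ∈ S, p = ZFSet.pair ξ y ∧ (∀ ζ ∈ ξ, ∃ x ∈ S, ZFSet.pair ζ x ∈ g) ∧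
    ∀ z ∈ S, z ∈ y ↔ ∃ ζ ∈ ξ, ∃ x ∈ S, ZFSet.pair ζ x ∈ g ∧ DefS S x z

/-- `δ` is collapsed by a function in a countable stage of the hierarchy, as seen in `S`. -/
def NotLCardS (δ : ZFSet.{0}) : Prop :=
  ∃ ξ ∈ S, IsOrd ξ ∧ CtblS S ξ ∧ ∃ g ∈ S, HierS S g ∧ ∃ M ∈ S, ZFSet.pair ξ M ∈ g ∧
    ∃ f ∈ M, ∃ α ∈ δ, IsSurjF α δ f

variable {S} in
/-- `e` codes an order isomorphism of `Z ∩ γ` with `δ`. -/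
def OrdIso (e Z γ δ : ZFSet.{0}) : Prop :=
  (∀ z ∈ Z, z ∈ γ → ∃ η ∈ δ, ZFSet.pair z η ∈ e) ∧
    (∀ η ∈ δ, ∃ z ∈ Z, z ∈ γ ∧ ZFSet.pair z η ∈ e) ∧
    ∀ z ∈ Z, ∀ w ∈ Z, z ∈ γ → w ∈ γ → ∀ η ∈ δ, ∀ ζ ∈ δ,
      ZFSet.pair z η ∈ e → ZFSet.pair w ζ ∈ e → (z ∈ w ↔ η ∈ ζ)

/-- No countable structure closed under pairing and `F` meets `γ` in a set whose order type is an
`L`-cardinal, as seen in `S`. -/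
def NoReflectS (F γ : ZFSet.{0}) : Prop :=
  ∀ Z ∈ S, CtblS S Z → ∅ ∈ Z → (∀ a ∈ Z, ∀ s ∈ Z, ∃ q ∈ Z, q = ZFSet.pair a s) →
    (∀ s ∈ Z, (∃ y ∈ S, ZFSet.pair s y ∈ F) → ∃ y ∈ Z, ZFSet.pair s y ∈ F) →
    ∃ δ ∈ S, IsOrd δ ∧ (∃ e ∈ S, OrdIso e Z γ δ) ∧ NotLCardS S δ

variable {S}

namespace Dfb

lemma ctblS (hS : PairClosed S) (i : Fin n) : Dfb S (fun v => CtblS S (v i)) := by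
  unfold CtblS OmegaS
  repeat' first
    | exact empty_mem hS _ | exact insert_mem hS _ _ | exact pair_mem hS _ _ _
    | exact mem _ _ | exact eq _ _ | apply and | apply bex hS | apply ball hS | apply ex
    | apply all | apply imp

lemma closedFamS (hS : PairClosed S) (i j : Fin n) :
    Dfb S (fun v => ClosedFamS S (v i) (v j)) := by
  unfold ClosedFamS
  repeat' first
    | exact eq_empty hS _ | exact pair_mem hS _ _ _ | exact eq_pair hS _ _ _
    | exact eq_pair_pair hS _ _ _ _ | exact mem _ _ | exact eq _ _ | apply not | apply and
    | apply iff | apply bex hS | apply ball hS | apply ex | apply all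

lemma defS (hS : PairClosed S) (i j : Fin n) : Dfb S (fun v => DefS S (v i) (v j)) := by
  unfold DefS
  repeat' first
    | exact closedFamS hS _ _ | exact pair_mem hS _ _ _ | exact mem _ _ | apply and
    | apply iff | apply bex hS | apply ball hS | apply ex | apply all | apply imp

lemma hierS (hS : PairClosed S) (i : Fin n) : Dfb S (fun v => HierS S (v i)) := by
  unfold HierS
  repeat' first
    | exact defS hS _ _ | exact pair_mem hS _ _ _ | exact eq_pair hS _ _ _ | exact mem _ _
    | apply and | apply iff | apply bex hS | apply ball hS | apply ex | apply all

lemma notLCardS (hS : PairClosed S) (i : Fin n) : Dfb S (fun v => NotLCardS S (v i)) := by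
  unfold NotLCardS
  repeat' first
    | exact isOrd hS _ | exact ctblS hS _ | exact hierS hS _ | exact isSurjF hS _ _ _
    | exact pair_mem hS _ _ _ | apply and | apply bex hS | apply ex

lemma ordIso (hS : PairClosed S) (i j k l : Fin n) :
    Dfb S (fun v => OrdIso (v i) (v j) (v k) (v l)) := by
  unfold OrdIso
  repeat' first
    | exact pair_mem hS _ _ _ | exact mem _ _ | apply and | apply iff | apply bex hS
    | apply ball hS | apply imp

lemma noReflectS (hS : PairClosed S) (i j : Fin n) :
    Dfb S (fun v => NoReflectS S (v i) (v j)) := by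
  unfold NoReflectS
  repeat' first
    | exact ctblS hS _ | exact empty_mem hS _ | exact isOrd hS _ | exact ordIso hS _ _ _ _
    | exact notLCardS hS _ | exact eq_pair hS _ _ _ | exact pair_mem hS _ _ _ | apply and
    | apply bex hS | apply ball hS | apply ex | apply all | apply imp

end Dfb

end Definability

/-! ### Evaluating the relativized notions -/

/-- A transitive class containing all its countable subsets. -/
structure CtblClosed (S : Set ZFSet.{0}) : Prop extends PairClosed S where
  ctbl : ∀ {x : ZFSet.{0}}, (∀ z ∈ x, z ∈ S) → Ctbl x → x ∈ S

/-- The code of a finite sequence as an iterated pair. -/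
def codeL : List ZFSet.{0} → ZFSet.{0}
  | [] => ∅
  | a :: l => ZFSet.pair a (codeL l)

lemma pair_ne_empty (a b : ZFSet.{0}) : ZFSet.pair a b ≠ ∅ := by
  intro h
  have : ({a} : ZFSet.{0}) ∈ ZFSet.pair a b := ZFSet.mem_pair.2 (Or.inl rfl)
  rw [h] at this
  exact ZFSet.notMem_empty _ this

lemma codeL_injective : Function.Injective codeL := by
  intro l
  induction l with
  | nil =>
    intro m h
    cases m with
    | nil => rfl
    | cons b m => exact absurd h.symm (pair_ne_empty _ _)
  | cons a l ih =>
    intro m h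
    cases m with
    | nil => exact absurd h (pair_ne_empty _ _)
    | cons b m =>
      rw [codeL, codeL, ZFSet.pair_inj] at h
      rw [h.1, ih h.2]

/-- The code of a finite tuple. -/
def codeV {n : ℕ} (v : Fin n → ZFSet.{0}) : ZFSet.{0} := codeL (List.ofFn v)

lemma codeV_cons {n : ℕ} (a : ZFSet.{0}) (v : Fin n → ZFSet.{0}) :
    codeV (Fin.cons a v : Fin (n + 1) → ZFSet.{0}) = ZFSet.pair a (codeV v) := by
  simp [codeV, codeL]

lemma codeV_zero (v : Fin 0 → ZFSet.{0}) : codeV v = ∅ := by simp [codeV, codeL]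

lemma codeV_inj {n m : ℕ} {v : Fin n → ZFSet.{0}} {w : Fin m → ZFSet.{0}} (h : codeV v = codeV w) :
    n = m ∧ HEq v w := by
  have h := List.ofFn_inj'.1 (codeL_injective h)
  rw [Sigma.mk.injEq] at h
  exact h

lemma codeV_injective {n : ℕ} : Function.Injective (codeV : (Fin n → ZFSet.{0}) → ZFSet.{0}) :=
  fun _ _ h => eq_of_heq (codeV_inj h).2

lemma CtblClosed.empty_mem {S : Set ZFSet.{0}} (hS : CtblClosed S) : ∅ ∈ S :=
  hS.ctbl (by simp) (Set.countable_empty.mono fun z hz => ZFSet.notMem_empty z hz)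

lemma CtblClosed.codeL_mem {S : Set ZFSet.{0}} (hS : CtblClosed S) {l : List ZFSet.{0}}
    (hl : ∀ z ∈ l, z ∈ S) : codeL l ∈ S := by
  induction l with
  | nil => exact hS.empty_mem
  | cons a l ih =>
    exact hS.pair (hl _ List.mem_cons_self) (ih fun z hz => hl z (List.mem_cons_of_mem _ hz))

/-- The set of codes of tuples from `A` satisfying `P`. -/
def tuples (A : ZFSet.{0}) {n : ℕ} (P : (Fin n → ZFSet.{0}) → Prop) : ZFSet.{0} :=
  ZFSet.range (fun v : {v : Fin n → A // P fun i => v i} => codeV fun i => (v.1 i : ZFSet.{0}))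

section Tuples

variable {A : ZFSet.{0}} {n : ℕ} {P Q : (Fin n → ZFSet.{0}) → Prop} {z : ZFSet.{0}}

lemma mem_tuples : z ∈ tuples A P ↔ ∃ v, (∀ i, v i ∈ A) ∧ P v ∧ z = codeV v := by
  unfold tuples
  rw [ZFSet.mem_range]
  constructor
  · rintro ⟨v, rfl⟩
    exact ⟨_, fun i => (v.1 i).2, v.2, rfl⟩
  · rintro ⟨v, hv, hP, rfl⟩
    exact ⟨⟨fun i => ⟨v i, hv i⟩, hP⟩, rfl⟩

lemma codeV_mem_tuples {v : Fin n → ZFSet.{0}} :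
    codeV v ∈ tuples A P ↔ (∀ i, v i ∈ A) ∧ P v := by
  rw [mem_tuples]
  constructor
  · rintro ⟨w, h1, h2, h⟩
    rw [codeV_injective h]; exact ⟨h1, h2⟩
  · exact fun h => ⟨v, h.1, h.2, rfl⟩

lemma pair_mem_tuples {P : (Fin (n + 1) → ZFSet.{0}) → Prop} {a s : ZFSet.{0}} :
    ZFSet.pair a s ∈ tuples A P ↔
      a ∈ A ∧ ∃ v, (∀ i, v i ∈ A) ∧ P (Fin.cons a v) ∧ s = codeV v := by
  rw [mem_tuples]
  constructor
  · rintro ⟨v, h1, h2, h⟩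
    rw [← Fin.cons_self_tail v, codeV_cons, ZFSet.pair_inj] at h
    obtain ⟨rfl, rfl⟩ := h
    exact ⟨h1 0, Fin.tail v, fun i => h1 i.succ, by rwa [Fin.cons_self_tail], rfl⟩
  · rintro ⟨ha, v, h1, h2, rfl⟩
    exact ⟨_, Fin.cases ha h1, h2, (codeV_cons _ _).symm⟩

lemma pair_notMem_tuples {P : (Fin 0 → ZFSet.{0}) → Prop} {a s : ZFSet.{0}} :
    ZFSet.pair a s ∉ tuples A P := by
  rw [mem_tuples]
  rintro ⟨v, -, -, h⟩
  exact pair_ne_empty _ _ (h.trans (codeV_zero v))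

lemma mem_tuples_succ {P : (Fin (n + 1) → ZFSet.{0}) → Prop} :
    z ∈ tuples A P ↔ ∃ a ∈ A, ∃ v, (∀ i, v i ∈ A) ∧ P (Fin.cons a v) ∧
      z = ZFSet.pair a (codeV v) := by
  constructor
  · intro h
    obtain ⟨v, -, -, rfl⟩ := mem_tuples.1 h
    rw [← Fin.cons_self_tail v, codeV_cons] at h ⊢
    obtain ⟨ha, w, h1, h2, h3⟩ := pair_mem_tuples.1 h
    exact ⟨_, ha, w, h1, h2, by rw [h3]⟩
  · rintro ⟨a, ha, v, h1, h2, rfl⟩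
    exact pair_mem_tuples.2 ⟨ha, v, h1, h2, rfl⟩

lemma mem_tuples_zero {P : (Fin 0 → ZFSet.{0}) → Prop} : z ∈ tuples A P ↔ z = ∅ ∧ P ![] := by
  rw [mem_tuples]
  constructor
  · rintro ⟨v, -, h, rfl⟩
    exact ⟨codeV_zero v, Subsingleton.elim v ![] ▸ h⟩
  · rintro ⟨rfl, h⟩
    exact ⟨_, fun i => i.elim0, h, (codeV_zero _).symm⟩

lemma mem_tuples_and_not : z ∈ tuples A (fun v => P v ∧ ¬ Q v) ↔
    z ∈ tuples A P ∧ ¬ z ∈ tuples A Q := by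
  constructor
  · intro h
    obtain ⟨v, h1, h2, rfl⟩ := mem_tuples.1 h
    rw [codeV_mem_tuples, codeV_mem_tuples]
    tauto
  · rintro ⟨h, h'⟩
    obtain ⟨v, h1, h2, rfl⟩ := mem_tuples.1 h
    rw [codeV_mem_tuples] at h' ⊢
    tauto

lemma mem_tuples_tail : z ∈ tuples A (fun v : Fin (n + 1) → ZFSet.{0} => P (Fin.tail v)) ↔
    ∃ a ∈ A, ∃ s ∈ tuples A P, z = ZFSet.pair a s := by
  simp only [mem_tuples_succ, Fin.tail_cons, mem_tuples]
  constructor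
  · rintro ⟨a, ha, v, h1, h2, rfl⟩
    exact ⟨a, ha, _, ⟨v, h1, h2, rfl⟩, rfl⟩
  · rintro ⟨a, ha, _, ⟨v, h1, h2, rfl⟩, rfl⟩
    exact ⟨a, ha, v, h1, h2, rfl⟩

lemma mem_tuples_skip {P : (Fin (n + 1) → ZFSet.{0}) → Prop} :
    z ∈ tuples A (fun v : Fin (n + 2) → ZFSet.{0} => P (Fin.cons (v 0) (Fin.tail (Fin.tail v)))) ↔
      ∃ a ∈ A, ∃ b ∈ A, ∃ s, ZFSet.pair a s ∈ tuples A P ∧ z = ZFSet.pair a (ZFSet.pair b s) := by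
  simp only [mem_tuples_succ (n := n + 1), Fin.tail_cons, Fin.cons_zero]
  constructor
  · rintro ⟨a, ha, v, h1, h2, rfl⟩
    refine ⟨a, ha, v 0, h1 0, codeV (Fin.tail v),
      pair_mem_tuples.2 ⟨ha, Fin.tail v, fun i => h1 i.succ, h2, rfl⟩, ?_⟩
    rw [← codeV_cons (v 0), Fin.cons_self_tail]
  · rintro ⟨a, ha, b, hb, s, h, rfl⟩
    obtain ⟨-, v, h1, h2, rfl⟩ := pair_mem_tuples.1 h
    exact ⟨a, ha, Fin.cons b v, Fin.cases hb h1, h2, by rw [codeV_cons]⟩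

lemma mem_tuples_rel {E : ZFSet.{0} → ZFSet.{0} → Prop} :
    z ∈ tuples A (fun v : Fin (n + 2) → ZFSet.{0} => E (v 0) (v 1) ∧ P (Fin.tail (Fin.tail v))) ↔
      ∃ a ∈ A, ∃ b ∈ A, ∃ s ∈ tuples A P, E a b ∧ z = ZFSet.pair a (ZFSet.pair b s) := by
  have h1 : (1 : Fin (n + 2)) = Fin.succ 0 := rfl
  simp only [mem_tuples_succ, Fin.tail_cons, mem_tuples, Fin.cons_zero, h1, Fin.cons_succ]
  constructor
  · rintro ⟨a, ha, v, h1, h2, rfl⟩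
    refine ⟨a, ha, v 0, h1 0, _, ⟨Fin.tail v, fun i => h1 i.succ, h2.2, rfl⟩, h2.1, ?_⟩
    rw [← codeV_cons (v 0), Fin.cons_self_tail]
  · rintro ⟨a, ha, b, hb, _, ⟨v, h1, h2, rfl⟩, he, rfl⟩
    exact ⟨a, ha, Fin.cons b v, Fin.cases hb h1, ⟨he, h2⟩, by rw [codeV_cons]⟩

lemma mem_tuples_ex {P : (Fin (n + 1) → ZFSet.{0}) → Prop} :
    z ∈ tuples A (fun v => ∃ a ∈ A, P (Fin.cons a v)) ↔
      ∃ a ∈ A, ZFSet.pair a z ∈ tuples A P := by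
  constructor
  · intro h
    obtain ⟨v, h1, ⟨a, ha, h2⟩, rfl⟩ := mem_tuples.1 h
    exact ⟨a, ha, pair_mem_tuples.2 ⟨ha, v, h1, h2, rfl⟩⟩
  · rintro ⟨a, ha, h⟩
    obtain ⟨-, v, h1, h2, rfl⟩ := pair_mem_tuples.1 h
    exact mem_tuples.2 ⟨v, h1, ⟨a, ha, h2⟩, rfl⟩

lemma mem_of_mem_tuples {S : Set ZFSet.{0}} (hS : CtblClosed S) (hA : A ∈ S)
    (hz : z ∈ tuples A P) : z ∈ S := by
  obtain ⟨v, h1, -, rfl⟩ := mem_tuples.1 hz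
  refine hS.codeL_mem fun x hx => ?_
  obtain ⟨i, rfl⟩ := (List.mem_ofFn' _ _).1 hx
  exact hS.trans hA (h1 i)

lemma ctbl_tuples (hA : Ctbl A) : Ctbl (tuples A P) := by
  refine ((countable_lists hA).image codeL).mono ?_
  intro z hz
  obtain ⟨v, h1, -, rfl⟩ := mem_tuples.1 hz
  refine ⟨List.ofFn v, fun x hx => ?_, rfl⟩
  obtain ⟨i, rfl⟩ := (List.mem_ofFn' _ _).1 hx
  exact h1 i

end Tuples

/-- Substitution of variables in a formula. -/
def Fml.rename : ∀ {n m : ℕ}, (Fin n → Fin m) → Fml n → Fml m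
  | _, _, f, .mem i j => .mem (f i) (f j)
  | _, _, f, .eq i j => .eq (f i) (f j)
  | _, _, f, .inA i => .inA (f i)
  | _, _, f, .inB i => .inB (f i)
  | _, _, f, .not φ => .not (φ.rename f)
  | _, _, f, .and φ ψ => .and (φ.rename f) (ψ.rename f)
  | _, _, f, .ex φ => .ex (φ.rename (Fin.cases 0 fun i => (f i).succ))

lemma satAB_rename {S A B : Set ZFSet.{0}} {n : ℕ} (φ : Fml n) :
    ∀ {m : ℕ} (f : Fin n → Fin m) (v : Fin m → ZFSet.{0}),
      SatAB S A B (φ.rename f) v ↔ SatAB S A B φ (fun i => v (f i)) := by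
  induction φ with
  | mem i j => intros; rfl
  | eq i j => intros; rfl
  | inA i => intros; rfl
  | inB i => intros; rfl
  | not φ ih => intro m f v; exact not_congr (ih f v)
  | and φ ψ ih ih' => intro m f v; exact and_congr (ih f v) (ih' f v)
  | ex φ ih =>
    intro m f v
    refine exists_congr fun x => and_congr_right fun _ => (ih _ _).trans ?_
    have : (fun i => (Fin.cons x v : Fin (m + 1) → ZFSet.{0})
        ((Fin.cases 0 (fun i => (f i).succ) : Fin _ → Fin (m + 1)) i)) =
        (Fin.cons x (fun i => v (f i)) : Fin _ → ZFSet.{0}) := by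
      funext i
      refine Fin.cases ?_ (fun i => ?_) i <;> simp
    rw [this]

section ClosedFam

variable {S : Set ZFSet.{0}} {A D : ZFSet.{0}}

/-- `D` contains the basic relations on `A` and is closed under the operations generating all
definable relations. -/
structure OpClosed (A D : ZFSet.{0}) : Prop where
  zero : tuples A (fun _ : Fin 0 → ZFSet.{0} => True) ∈ D
  diff : ∀ {n : ℕ} {P Q : (Fin n → ZFSet.{0}) → Prop}, tuples A P ∈ D → tuples A Q ∈ D →
    tuples A (fun v => P v ∧ ¬ Q v) ∈ D
  tail : ∀ {n : ℕ} {P : (Fin n → ZFSet.{0}) → Prop}, tuples A P ∈ D →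
    tuples A (fun v : Fin (n + 1) → ZFSet.{0} => P (Fin.tail v)) ∈ D
  skip : ∀ {n : ℕ} {P : (Fin (n + 1) → ZFSet.{0}) → Prop}, tuples A P ∈ D →
    tuples A (fun v : Fin (n + 2) → ZFSet.{0} => P (Fin.cons (v 0) (Fin.tail (Fin.tail v)))) ∈ D
  mem : ∀ {n : ℕ} {P : (Fin n → ZFSet.{0}) → Prop}, tuples A P ∈ D →
    tuples A (fun v : Fin (n + 2) → ZFSet.{0} => v 0 ∈ v 1 ∧ P (Fin.tail (Fin.tail v))) ∈ D
  mem' : ∀ {n : ℕ} {P : (Fin n → ZFSet.{0}) → Prop}, tuples A P ∈ D →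
    tuples A (fun v : Fin (n + 2) → ZFSet.{0} => v 1 ∈ v 0 ∧ P (Fin.tail (Fin.tail v))) ∈ D
  eq : ∀ {n : ℕ} {P : (Fin n → ZFSet.{0}) → Prop}, tuples A P ∈ D →
    tuples A (fun v : Fin (n + 2) → ZFSet.{0} => v 0 = v 1 ∧ P (Fin.tail (Fin.tail v))) ∈ D
  ex : ∀ {n : ℕ} {P : (Fin (n + 1) → ZFSet.{0}) → Prop}, tuples A P ∈ D →
    tuples A (fun v => ∃ a ∈ A, P (Fin.cons a v)) ∈ D

lemma ClosedFamS.opClosed (hS : CtblClosed S) (hA : A ∈ S) (hD : D ∈ S)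
    (h : ClosedFamS S A D) : OpClosed A D := by
  have key : ∀ {n : ℕ} {P : (Fin n → ZFSet.{0}) → Prop} {p : ZFSet.{0} → Prop},
      (∃ Q ∈ D, ∀ z ∈ S, z ∈ Q ↔ p z) → (∀ z ∈ S, z ∈ tuples A P ↔ p z) → tuples A P ∈ D := by
    rintro n P p ⟨Q, hQ, h⟩ h'
    have : tuples A P = Q := by
      ext z
      constructor
      · intro hz
        have hzS := mem_of_mem_tuples hS hA hz
        exact (h z hzS).2 ((h' z hzS).1 hz)
      · intro hz
        have hzS := hS.trans (hS.trans hD hQ) hz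
        exact (h' z hzS).2 ((h z hzS).1 hz)
    rwa [this]
  obtain ⟨h0, h⟩ := h
  constructor
  · exact key h0 fun z _ => by simp [mem_tuples_zero]
  · exact fun hP hQ => key ((h _ hP).1 _ hQ) fun z _ => mem_tuples_and_not
  · exact fun hP => key (h _ hP).2.1 fun z _ => mem_tuples_tail
  · refine fun hP => key (h _ hP).2.2.1 fun z hz => mem_tuples_skip.trans ?_
    refine exists_congr fun a => and_congr_right fun _ => exists_congr fun b =>
      and_congr_right fun _ => exists_congr fun s => ⟨fun hs => ⟨?_, hs⟩, fun hs => hs.2⟩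
    exact (hS.of_pair (mem_of_mem_tuples hS hA hs.1)).2
  · exact fun hP => key (h _ hP).2.2.2.1 fun z _ => mem_tuples_rel (E := fun a b => a ∈ b)
  · exact fun hP => key (h _ hP).2.2.2.2.1 fun z _ => mem_tuples_rel (E := fun a b => b ∈ a)
  · exact fun hP => key (h _ hP).2.2.2.2.2.1 fun z _ => mem_tuples_rel (E := fun a b => a = b)
  · exact fun hP => key (h _ hP).2.2.2.2.2.2 fun z _ => mem_tuples_ex

namespace OpClosed

lemma univ (h : OpClosed A D) : ∀ n : ℕ, tuples A (fun _ : Fin n → ZFSet.{0} => True) ∈ D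
  | 0 => h.zero
  | n + 1 => h.tail (univ h n)

lemma not (h : OpClosed A D) {n : ℕ} {P : (Fin n → ZFSet.{0}) → Prop} (hP : tuples A P ∈ D) :
    tuples A (fun v => ¬ P v) ∈ D := by
  have := h.diff (h.univ n) hP
  simpa using this

lemma false (h : OpClosed A D) (n : ℕ) : tuples A (fun _ : Fin n → ZFSet.{0} => False) ∈ D := by
  have := h.not (h.univ n)
  simpa using this

lemma and (h : OpClosed A D) {n : ℕ} {P Q : (Fin n → ZFSet.{0}) → Prop} (hP : tuples A P ∈ D)
    (hQ : tuples A Q ∈ D) : tuples A (fun v => P v ∧ Q v) ∈ D := by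
  have := h.diff hP (h.not hQ)
  simpa using this

lemma rel_zero (h : OpClosed A D) {E : ZFSet.{0} → ZFSet.{0} → Prop}
    (hE : ∀ n : ℕ, tuples A (fun v : Fin (n + 2) → ZFSet.{0} => E (v 0) (v 1)) ∈ D) :
    ∀ (n : ℕ) (j : Fin n), tuples A (fun v : Fin (n + 1) → ZFSet.{0} => E (v 0) (v j.succ)) ∈ D
  | 0, j => j.elim0
  | n + 1, j => by
    refine Fin.cases (hE n) (fun j => ?_) j
    have := h.skip (rel_zero h hE n j)
    simpa [Fin.tail] using this

lemma rel (h : OpClosed A D) {E : ZFSet.{0} → ZFSet.{0} → Prop}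
    (hE : ∀ n : ℕ, tuples A (fun v : Fin (n + 2) → ZFSet.{0} => E (v 0) (v 1)) ∈ D)
    (hE' : ∀ n : ℕ, tuples A (fun v : Fin (n + 2) → ZFSet.{0} => E (v 1) (v 0)) ∈ D)
    (hd : ∀ n : ℕ, tuples A (fun v : Fin (n + 1) → ZFSet.{0} => E (v 0) (v 0)) ∈ D) :
    ∀ (n : ℕ) (i j : Fin n), tuples A (fun v : Fin n → ZFSet.{0} => E (v i) (v j)) ∈ D
  | 0, i, _ => i.elim0
  | n + 1, i, j => by
    refine Fin.cases ?_ (fun i => ?_) i <;> refine Fin.cases ?_ (fun j => ?_) j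
    · exact hd n
    · exact h.rel_zero hE n j
    · exact h.rel_zero (E := fun a b => E b a) hE' n i
    · exact h.tail (rel h hE hE' hd n i j)

lemma sat (h : OpClosed A D) {n : ℕ} (φ : Fml n) : tuples A (SatAB A.toSet ∅ ∅ φ) ∈ D := by
  induction φ with
  | mem i j =>
    refine h.rel (E := fun a b => a ∈ b) (fun n => ?_) (fun n => ?_) (fun n => ?_) _ i j
    · simpa using h.mem (h.univ n)
    · simpa using h.mem' (h.univ n)
    · simpa [ZFSet.mem_irrefl] using h.false (n + 1)
  | eq i j =>
    refine h.rel (E := fun a b => a = b) (fun n => ?_) (fun n => ?_) (fun n => ?_) _ i j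
    · simpa using h.eq (h.univ n)
    · simpa [eq_comm] using h.eq (h.univ n)
    · simpa using h.univ (n + 1)
  | inA i => simpa [SatAB] using h.false _
  | inB i => simpa [SatAB] using h.false _
  | not φ ih => exact h.not ih
  | and φ ψ ih ih' => exact h.and ih ih'
  | ex φ ih => exact h.ex ih

end OpClosed

/-- The family of all definable relations on `A`. -/
def defRels (A : ZFSet.{0}) : ZFSet.{0} :=
  ZFSet.range (fun p : Σ n : ℕ, Fml n => tuples A (SatAB A.toSet ∅ ∅ p.2))

lemma mem_defRels {R : ZFSet.{0}} :
    R ∈ defRels A ↔ ∃ (n : ℕ) (φ : Fml n), tuples A (SatAB A.toSet ∅ ∅ φ) = R := by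
  simp [defRels]

lemma closedFamS_defRels (hS : CtblClosed S) (hA : A ∈ S) : ClosedFamS S A (defRels A) := by
  have key : ∀ {n : ℕ} (φ : Fml n) {p : ZFSet.{0} → Prop},
      (∀ z, z ∈ tuples A (SatAB A.toSet ∅ ∅ φ) ↔ p z) → ∃ Q ∈ defRels A, ∀ z ∈ S, z ∈ Q ↔ p z :=
    fun φ _ h => ⟨_, mem_defRels.2 ⟨_, φ, rfl⟩, fun z _ => h z⟩
  have sat_tail : ∀ {n : ℕ} (φ : Fml n), SatAB A.toSet ∅ ∅ (φ.rename Fin.succ) =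
      fun v => SatAB A.toSet ∅ ∅ φ (Fin.tail v) :=
    fun φ => funext fun v => propext (satAB_rename φ _ _)
  have sat_rel : ∀ {n : ℕ} (φ : Fml n) (χ : Fml (n + 2)), SatAB A.toSet ∅ ∅
      (.and χ ((φ.rename Fin.succ).rename Fin.succ)) =
      fun v => SatAB A.toSet ∅ ∅ χ v ∧ SatAB A.toSet ∅ ∅ φ (Fin.tail (Fin.tail v)) :=
    fun φ χ => funext fun v => propext (and_congr_right fun _ =>
      (satAB_rename _ _ _).trans (satAB_rename _ _ _))
  have empty : ∀ {p : ZFSet.{0} → Prop}, (∀ z, ¬ p z) → ∃ Q ∈ defRels A, ∀ z ∈ S, z ∈ Q ↔ p z :=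
    fun hp => key (n := 0) (.ex (.not (.eq 0 0))) fun z => by
      rw [mem_tuples_zero]
      simp [SatAB, hp]
  refine ⟨key (n := 0) (.not (.ex (.not (.eq 0 0)))) fun z => ?_, ?_⟩
  · rw [mem_tuples_zero]
    simp [SatAB]
  intro R hR
  obtain ⟨n, φ, rfl⟩ := mem_defRels.1 hR
  refine ⟨fun T hT => ?_, ?_, ?_, ?_, ?_, ?_, ?_⟩
  · obtain ⟨m, ψ, rfl⟩ := mem_defRels.1 hT
    by_cases hnm : n = m
    · subst hnm
      exact key (.and φ (.not ψ)) fun z => mem_tuples_and_not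
    · refine key φ fun z => ⟨fun h => ⟨h, fun h' => hnm ?_⟩, fun h => h.1⟩
      obtain ⟨v, -, -, rfl⟩ := mem_tuples.1 h
      obtain ⟨w, -, -, e⟩ := mem_tuples.1 h'
      exact (codeV_inj e).1
  · refine key (φ.rename Fin.succ) fun z => ?_
    rw [sat_tail]
    exact mem_tuples_tail
  · cases n with
    | zero =>
      refine empty ?_
      rintro z ⟨a, -, b, -, s, -, h, -⟩
      exact pair_notMem_tuples h
    | succ n =>
      refine key (φ.rename (Fin.cases 0 fun i => i.succ.succ)) fun z => ?_
      have : SatAB A.toSet ∅ ∅ (φ.rename (Fin.cases 0 fun i => i.succ.succ)) =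
          fun v : Fin (n + 2) → ZFSet.{0} =>
            SatAB A.toSet ∅ ∅ φ (Fin.cons (v 0) (Fin.tail (Fin.tail v))) := by
        funext v
        rw [satAB_rename]
        congr 1
        funext i
        refine Fin.cases ?_ (fun i => ?_) i <;> simp [Fin.tail]
      rw [this, mem_tuples_skip]
      refine exists_congr fun a => and_congr_right fun _ => exists_congr fun b =>
        and_congr_right fun _ => exists_congr fun s => ⟨fun hs => ⟨?_, hs⟩, fun hs => hs.2⟩
      exact (hS.of_pair (mem_of_mem_tuples hS hA hs.1)).2
  · refine key (.and (.mem 0 1) ((φ.rename Fin.succ).rename Fin.succ)) fun z => ?_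
    rw [sat_rel φ (.mem 0 1)]
    exact mem_tuples_rel (E := fun a b => a ∈ b)
  · refine key (.and (.mem 1 0) ((φ.rename Fin.succ).rename Fin.succ)) fun z => ?_
    rw [sat_rel φ (.mem 1 0)]
    exact mem_tuples_rel (E := fun a b => b ∈ a)
  · refine key (.and (.eq 0 1) ((φ.rename Fin.succ).rename Fin.succ)) fun z => ?_
    rw [sat_rel φ (.eq 0 1)]
    exact mem_tuples_rel (E := fun a b => a = b)
  · cases n with
    | zero =>
      refine empty ?_
      rintro z ⟨a, -, h⟩
      exact pair_notMem_tuples h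
    | succ n => exact key (.ex φ) fun z => mem_tuples_ex

lemma defRels_mem (hS : CtblClosed S) (hA : A ∈ S) (hc : Ctbl A) : defRels A ∈ S := by
  refine hS.ctbl (fun R hR => ?_) ?_
  · obtain ⟨n, φ, rfl⟩ := mem_defRels.1 hR
    exact hS.ctbl (fun z hz => mem_of_mem_tuples hS hA hz) (ctbl_tuples hc)
  · refine (Set.countable_range fun p : Σ n : ℕ, Fml n =>
      tuples A (SatAB A.toSet ∅ ∅ p.2)).mono fun R hR => ?_
    obtain ⟨n, φ, rfl⟩ := mem_defRels.1 hR
    exact ⟨⟨n, φ⟩, rfl⟩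

lemma defS_iff {B : ZFSet.{0}} (hS : CtblClosed S) (hA : A ∈ S) (hc : Ctbl A) (hB : B ∈ S) :
    DefS S A B ↔ B ∈ DefSetA ∅ A := by
  rw [mem_DefSetA]
  constructor
  · intro h
    obtain ⟨R, hR, s, -, hs⟩ := h _ (defRels_mem hS hA hc) (closedFamS_defRels hS hA)
    obtain ⟨n, φ, rfl⟩ := mem_defRels.1 hR
    have hs' : ∀ z, z ∈ B ↔ z ∈ A ∧ ZFSet.pair z s ∈ tuples A (SatAB A.toSet ∅ ∅ φ) := fun z =>
      ⟨fun hz => (hs z (hS.trans hB hz)).1 hz, fun hz => (hs z (hS.trans hA hz.1)).2 hz⟩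
    by_cases hne : ∃ z, z ∈ B
    · obtain ⟨z, hz⟩ := hne
      cases n with
      | zero => exact absurd ((hs' z).1 hz).2 pair_notMem_tuples
      | succ n =>
        obtain ⟨-, v, hv, -, rfl⟩ := pair_mem_tuples.1 ((hs' z).1 hz).2
        refine ⟨n, φ, v, hv, ?_⟩
        ext y
        rw [hs', mem_defSub]
        refine and_congr_right fun hy => ?_
        rw [← codeV_cons, codeV_mem_tuples, and_iff_right]
        exact Fin.cases hy hv
    · refine ⟨0, .not (.eq 0 0), ![], fun i => i.elim0, ?_⟩
      ext y
      rw [mem_defSub]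
      simp only [SatAB, not_true_eq_false, and_false, iff_false]
      exact fun hy => hne ⟨y, hy⟩
  · rintro ⟨n, φ, v, hv, rfl⟩ D hD hcl
    refine ⟨_, (hcl.opClosed hS hA hD).sat φ, codeV v, ?_, fun z _ => ?_⟩
    · exact mem_of_mem_tuples hS hA (codeV_mem_tuples (P := fun _ => True).2 ⟨hv, trivial⟩)
    · rw [mem_defSub]
      refine and_congr_right fun hy => ?_
      rw [← codeV_cons, codeV_mem_tuples, and_iff_right]
      exact Fin.cases hy hv

end ClosedFam

lemma CtblClosed.ord_mem {S : Set ZFSet.{0}} (hS : CtblClosed S) {α : ZFSet.{0}} (hα : IsOrd α)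
    (hc : Ctbl α) : α ∈ S := by
  induction α using ZFSet.inductionOn with
  | _ α ih =>
    exact hS.ctbl (fun β hβ => ih β hβ (hα.mem hβ) (hc.mono (hα.1 β hβ))) hc

lemma isOrd_omega : IsOrd ZFSet.omega := isOrd_iff.2 (omega_eq ▸ ZFSet.isOrdinal_toZFSet _)

lemma ctbl_omega : Ctbl ZFSet.omega := ctbl_iff.2 card_omega.le

lemma ctbl_img {f : ZFSet.{0} → ZFSet.{0}} {x : ZFSet.{0}} (hx : Ctbl x) : Ctbl (img f x) :=
  (Set.Countable.image hx f).mono fun _ hz => mem_img.1 hz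

lemma ctblS_iff {S : Set ZFSet.{0}} (hS : CtblClosed S) {x : ZFSet.{0}} (hx : x ∈ S) :
    CtblS S x ↔ Ctbl x := by
  have hω : ZFSet.omega ∈ S := hS.ord_mem isOrd_omega ctbl_omega
  constructor
  · rintro ⟨c, -, w, -, ⟨⟨-, -⟩, hw⟩, h1, h2⟩
    have hw : Ctbl w := ctbl_omega.mono
      (hw _ hω ⟨ZFSet.omega_zero, fun y hy => ZFSet.omega_succ hy⟩)
    choose! m hm hmc using h1
    exact Set.MapsTo.countable_of_injOn (f := m) hm
      (fun y hy z hz e => h2 _ (hm y hy) y hy z hz (hmc y hy) (e ▸ hmc z hz)) hw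
  · intro hc
    obtain ⟨f, hf⟩ := Set.countable_iff_exists_injOn.1 hc
    refine ⟨img (fun y => ZFSet.pair (natZ (f y)) y) x, hS.ctbl ?_ (ctbl_img hc), ZFSet.omega, hω,
      ⟨⟨ZFSet.omega_zero, fun y hy => ZFSet.omega_succ hy⟩, ?_⟩, ?_, ?_⟩
    · intro z hz
      obtain ⟨y, hy, rfl⟩ := mem_img.1 hz
      exact hS.pair (hS.trans hω (mem_omega.2 ⟨_, rfl⟩)) (hS.trans hx hy)
    · rintro u - ⟨hu0, hu⟩ y hy
      obtain ⟨n, rfl⟩ := mem_omega.1 hy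
      induction n with
      | zero => exact hu0
      | succ n ih => exact hu _ (ih (mem_omega.2 ⟨n, rfl⟩))
    · exact fun y hy => ⟨_, mem_omega.2 ⟨f y, rfl⟩, mem_img.2 ⟨y, hy, rfl⟩⟩
    · intro m _ y hy z hz h1 h2
      obtain ⟨y', hy', e1⟩ := mem_img.1 h1
      obtain ⟨z', hz', e2⟩ := mem_img.1 h2
      obtain ⟨k1, rfl⟩ := ZFSet.pair_inj.1 e1
      obtain ⟨k2, rfl⟩ := ZFSet.pair_inj.1 e2
      exact hf hy' hz' (natZ_injective (k1.trans k2.symm))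

lemma ctbl_DefSetA {A : ZFSet.{0}} (hA : Ctbl A) : Ctbl (DefSetA ∅ A) := by
  refine (((Set.countable_univ (α := Σ n : ℕ, Fml (n + 1))).prod (countable_lists hA)).image
    fun q => defSub A q.1.2 fun i => q.2.getD i ∅).mono fun B hB => ?_
  obtain ⟨n, φ, v, hv, rfl⟩ := mem_DefSetA.1 hB
  refine ⟨(⟨n, φ⟩, List.ofFn v), ⟨Set.mem_univ _, fun x hx => ?_⟩, ?_⟩
  · obtain ⟨i, rfl⟩ := (List.mem_ofFn' _ _).1 hx
    exact hv i
  · simp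

lemma ctbl_Lstage {α : ZFSet.{0}} (hα : IsOrd α) (hc : Ctbl α) : Ctbl (Lstage α) := by
  induction α using ZFSet.inductionOn with
  | _ α ih =>
    refine (Set.Countable.biUnion hc fun β hβ => ?_ :
      (⋃ β ∈ α.toSet, (DefSetA ∅ (Lstage β)).toSet).Countable).mono fun z hz => ?_
    · exact ctbl_DefSetA (ih β hβ (hα.mem hβ) (hc.mono (hα.1 β hβ)))
    · obtain ⟨β, hβ, hz⟩ := mem_Lstage.1 hz
      exact Set.mem_iUnion₂.2 ⟨β, hβ, hz⟩

lemma CtblClosed.Lstage_mem {S : Set ZFSet.{0}} (hS : CtblClosed S) {α : ZFSet.{0}}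
    (hα : IsOrd α) (hc : Ctbl α) : Lstage α ∈ S := by
  induction α using ZFSet.inductionOn with
  | _ α ih =>
    refine hS.ctbl (fun z hz => ?_) (ctbl_Lstage hα hc)
    obtain ⟨β, hβ, hz⟩ := mem_Lstage.1 hz
    have hcβ := hc.mono (hα.1 β hβ)
    have hsub := subset_of_mem_DefSetA hz
    exact hS.ctbl (fun y hy => hS.trans (ih β hβ (hα.mem hβ) hcβ) (hsub hy))
      ((ctbl_Lstage (hα.mem hβ) hcβ).mono hsub)

lemma HierS.eq_Lstage {S : Set ZFSet.{0}} (hS : CtblClosed S) {g : ZFSet.{0}}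
    (h : HierS S g) {ξ : ZFSet.{0}} (hξ : IsOrd ξ) (hc : Ctbl ξ) :
    ∀ {y : ZFSet.{0}}, ZFSet.pair ξ y ∈ g → y = Lstage ξ := by
  induction ξ using ZFSet.inductionOn with
  | _ ξ ih =>
    intro y hy
    obtain ⟨ξ', -, y', hyS, e, h1, h2⟩ := h _ hy
    obtain ⟨rfl, rfl⟩ := ZFSet.pair_inj.1 e
    have key : ∀ z ∈ S, z ∈ y ↔ z ∈ Lstage ξ := by
      intro z hz
      rw [h2 z hz, mem_Lstage]
      refine exists_congr fun ζ => and_congr_right fun hζ => ?_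
      have hcζ := hc.mono (hξ.1 ζ hζ)
      have hL := hS.Lstage_mem (hξ.mem hζ) hcζ
      have hLc := ctbl_Lstage (hξ.mem hζ) hcζ
      constructor
      · rintro ⟨x, -, hx, hd⟩
        rw [ih ζ hζ (hξ.mem hζ) hcζ hx] at hd
        exact (defS_iff hS hL hLc hz).1 hd
      · intro hd
        obtain ⟨x, hxS, hx⟩ := h1 ζ hζ
        refine ⟨x, hxS, hx, ?_⟩
        rw [ih ζ hζ (hξ.mem hζ) hcζ hx]
        exact (defS_iff hS hL hLc hz).2 hd
    ext z
    exact ⟨fun hz => (key z (hS.trans hyS hz)).1 hz,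
      fun hz => (key z (hS.trans (hS.Lstage_mem hξ hc) hz)).2 hz⟩

lemma exists_hierS {S : Set ZFSet.{0}} (hS : CtblClosed S) {ξ : ZFSet.{0}} (hξ : IsOrd ξ)
    (hc : Ctbl ξ) : ∃ g ∈ S, HierS S g ∧ ZFSet.pair ξ (Lstage ξ) ∈ g := by
  have hins : ∀ η ∈ insert ξ ξ, IsOrd η ∧ Ctbl η ∧ ∀ ζ ∈ η, ζ ∈ insert ξ ξ := by
    intro η hη
    rcases ZFSet.mem_insert_iff.1 hη with rfl | hη
    · exact ⟨hξ, hc, fun ζ hζ => ZFSet.mem_insert_of_mem _ hζ⟩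
    · exact ⟨hξ.mem hη, hc.mono (hξ.1 η hη),
        fun ζ hζ => ZFSet.mem_insert_of_mem _ (hξ.1 η hη hζ)⟩
  have hmem : ∀ {η x : ZFSet.{0}}, ZFSet.pair η x ∈
      img (fun η => ZFSet.pair η (Lstage η)) (insert ξ ξ) ↔ η ∈ insert ξ ξ ∧ x = Lstage η := by
    intro η x
    rw [mem_img]
    constructor
    · rintro ⟨η', hη', e⟩
      obtain ⟨rfl, rfl⟩ := ZFSet.pair_inj.1 e
      exact ⟨hη', rfl⟩
    · rintro ⟨h, rfl⟩
      exact ⟨η, h, rfl⟩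
  refine ⟨img (fun η => ZFSet.pair η (Lstage η)) (insert ξ ξ), hS.ctbl ?_ (ctbl_img ?_), ?_,
    hmem.2 ⟨ZFSet.mem_insert _ _, rfl⟩⟩
  · intro z hz
    obtain ⟨η, hη, rfl⟩ := mem_img.1 hz
    obtain ⟨h1, h2, -⟩ := hins η hη
    exact hS.pair (hS.ord_mem h1 h2) (hS.Lstage_mem h1 h2)
  · exact (Set.Countable.insert ξ hc).mono fun z hz => ZFSet.mem_insert_iff.1 hz
  · intro p hp
    obtain ⟨η, hη, rfl⟩ := mem_img.1 hp
    obtain ⟨h1, h2, h3⟩ := hins η hη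
    refine ⟨η, hS.ord_mem h1 h2, _, hS.Lstage_mem h1 h2, rfl, ?_, ?_⟩
    · intro ζ hζ
      exact ⟨_, hS.Lstage_mem (h1.mem hζ) (h2.mono (h1.1 ζ hζ)), hmem.2 ⟨h3 ζ hζ, rfl⟩⟩
    · intro z hz
      rw [mem_Lstage]
      refine exists_congr fun ζ => and_congr_right fun hζ => ?_
      have hcζ := h2.mono (h1.1 ζ hζ)
      have hL := hS.Lstage_mem (h1.mem hζ) hcζ
      have hLc := ctbl_Lstage (h1.mem hζ) hcζ
      constructor
      · exact fun hd => ⟨_, hL, hmem.2 ⟨h3 ζ hζ, rfl⟩, (defS_iff hS hL hLc hz).2 hd⟩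
      · rintro ⟨x, -, hx, hd⟩
        rw [(hmem.1 hx).2] at hd
        exact (defS_iff hS hL hLc hz).1 hd

lemma NotLCardS.not_lCard {S : Set ZFSet.{0}} (hS : CtblClosed S) {δ : ZFSet.{0}}
    (h : NotLCardS S δ) : ¬ LCard δ := by
  obtain ⟨ξ, hξS, hξ, hc, g, -, hg, M, -, hM, f, hf, α, hα, hs⟩ := h
  have hc := (ctblS_iff hS hξS).1 hc
  rw [hg.eq_Lstage hS hξ hc hM] at hf
  exact fun h => h.2 α hα f ⟨ξ, hξ, hf⟩ hs

lemma notLCardS_of_mem_Lstage {S : Set ZFSet.{0}} (hS : CtblClosed S) {δ ξ α f : ZFSet.{0}}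
    (hξ : IsOrd ξ) (hc : Ctbl ξ) (hf : f ∈ Lstage ξ) (hα : α ∈ δ) (h : IsSurjF α δ f) :
    NotLCardS S δ := by
  obtain ⟨g, hgS, hg, hL⟩ := exists_hierS hS hξ hc
  have hξS := hS.ord_mem hξ hc
  exact ⟨ξ, hξS, hξ, (ctblS_iff hS hξS).2 hc, g, hgS, hg, _, hS.Lstage_mem hξ hc, hL, f, hf, α,
    hα, h⟩

lemma ctblClosed_Hset {κ : ZFSet.{0}} (hκ : IsRegular κ) (hω : ZFSet.omega ∈ κ) :
    CtblClosed (Hset κ) where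
  trans := Hset.trans
  upair := Hset.pair_set hκ hω
  ctbl := Hset.mem_of_ctbl hκ hω

/-! ### Condensation for countable structures -/

lemma IsOrd.collapse {X γ : ZFSet.{0}} (hγ : IsOrd γ) : IsOrd (collapse X γ) := by
  have key : ∀ γ : ZFSet.{0}, γ.IsTransitive → (SRPPaper.collapse X γ).IsTransitive := by
    intro γ hγ y hy z hz
    obtain ⟨w, hw, -, rfl⟩ := mem_collapse.1 hy
    obtain ⟨u, hu, huX, rfl⟩ := mem_collapse.1 hz
    exact mem_collapse.2 ⟨u, hγ w hw hu, huX, rfl⟩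
  refine ⟨key γ hγ.1, fun y hy => ?_⟩
  obtain ⟨w, hw, -, rfl⟩ := mem_collapse.1 hy
  exact key w (hγ.2 w hw)

lemma ctbl_collapse {X γ : ZFSet.{0}} (hX : Ctbl X) : Ctbl (collapse X γ) :=
  (Set.Countable.image hX (collapse X)).mono fun z hz => by
    obtain ⟨w, -, hw, rfl⟩ := mem_collapse.1 hz
    exact ⟨w, hw, rfl⟩

/-- Every two distinct elements of `X` are separated by an element of `X`. -/
def Extensional (X : ZFSet.{0}) : Prop :=
  ∀ x ∈ X, ∀ y ∈ X, (∀ z ∈ X, z ∈ x ↔ z ∈ y) → x = y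

section Collapse

variable {X : ZFSet.{0}}

lemma mem_collapse_of_mem {x y : ZFSet.{0}} (hx : x ∈ X) (h : x ∈ y) :
    collapse X x ∈ collapse X y := mem_collapse.2 ⟨x, h, hx, rfl⟩

lemma Extensional.collapse_inj (hX : Extensional X) {x y : ZFSet.{0}} (hx : x ∈ X) (hy : y ∈ X)
    (h : collapse X x = collapse X y) : x = y := by
  induction x using ZFSet.inductionOn generalizing y with
  | _ x ih =>
    refine hX x hx y hy fun z hz => ⟨fun hzx => ?_, fun hzy => ?_⟩
    · obtain ⟨w, hw, hwX, e⟩ := mem_collapse.1 (h ▸ mem_collapse_of_mem hz hzx)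
      rwa [ih z hzx hz hwX e.symm]
    · obtain ⟨w, hw, hwX, e⟩ := mem_collapse.1 (h ▸ mem_collapse_of_mem hz hzy)
      rwa [← ih w hw hwX hz e]

lemma Extensional.collapse_mem (hX : Extensional X) {x y : ZFSet.{0}} (hx : x ∈ X) :
    collapse X x ∈ collapse X y ↔ x ∈ y := by
  refine ⟨fun h => ?_, mem_collapse_of_mem hx⟩
  obtain ⟨w, hw, hwX, e⟩ := mem_collapse.1 h
  rwa [← hX.collapse_inj hwX hx e]

lemma collapse_eq_self {t x : ZFSet.{0}} (ht : t.IsTransitive) (htX : t ⊆ X) (hx : x ∈ t) :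
    collapse X x = x := by
  induction x using ZFSet.inductionOn with
  | _ x ih =>
    ext z
    rw [mem_collapse]
    constructor
    · rintro ⟨w, hw, -, rfl⟩
      rwa [ih w hw (ht x hx hw)]
    · exact fun hz => ⟨z, hz, htX (ht x hx hz), ih z hz (ht x hx hz)⟩

lemma Extensional.satAB_collapse (hX : Extensional X) {N : Set ZFSet.{0}} (hN : N ⊆ X.toSet)
    {n : ℕ} (φ : Fml n) : ∀ v : Fin n → ZFSet.{0}, (∀ i, v i ∈ N) →
    (SatAB (collapse X '' N) ∅ ∅ φ (fun i => collapse X (v i)) ↔ SatAB N ∅ ∅ φ v) := by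
  induction φ with
  | mem i j => exact fun v hv => hX.collapse_mem (hN (hv i))
  | eq i j =>
    exact fun v hv => ⟨fun h => hX.collapse_inj (hN (hv i)) (hN (hv j)) h, fun h => congrArg _ h⟩
  | inA i => exact fun v hv => Iff.rfl
  | inB i => exact fun v hv => Iff.rfl
  | not φ ih => exact fun v hv => not_congr (ih v hv)
  | and φ ψ ih ih' => exact fun v hv => and_congr (ih v hv) (ih' v hv)
  | ex φ ih =>
    intro v hv
    have hcons : ∀ x, (fun i => collapse X ((Fin.cons x v : Fin _ → ZFSet.{0}) i)) =
        (Fin.cons (collapse X x) (fun i => collapse X (v i)) : Fin _ → ZFSet.{0}) := fun x => by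
      funext i
      refine Fin.cases ?_ (fun i => ?_) i <;> simp
    constructor
    · rintro ⟨_, ⟨x, hx, rfl⟩, h⟩
      exact ⟨x, hx, (ih _ (Fin.cases hx hv)).1 ((hcons x).symm ▸ h)⟩
    · rintro ⟨x, hx, h⟩
      exact ⟨_, ⟨x, hx, rfl⟩, (hcons x) ▸ (ih _ (Fin.cases hx hv)).2 h⟩

/-- Closure conditions on `X` ensuring that its collapse maps stages of the constructible
hierarchy to stages. -/
structure LClosed (X : ZFSet.{0}) : Prop where
  ext : Extensional X
  stage : ∀ α ∈ X, Lstage α ∈ X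
  witness : ∀ A ∈ X, ∀ (n : ℕ) (φ : Fml (n + 1)) (v : Fin n → ZFSet.{0}), (∀ i, v i ∈ X) →
    (∃ x ∈ A, SatAB A.toSet ∅ ∅ φ (Fin.cons x v)) →
    ∃ x ∈ X, x ∈ A ∧ SatAB A.toSet ∅ ∅ φ (Fin.cons x v)
  def_mem : ∀ A ∈ X, ∀ (n : ℕ) (φ : Fml (n + 1)) (v : Fin n → ZFSet.{0}), (∀ i, v i ∈ X) →
    defSub A φ v ∈ X
  level : ∀ x ∈ X, ∀ α ∈ X, x ∈ Lstage α → ∃ β ∈ X, β ∈ α ∧ x ∈ DefSetA ∅ (Lstage β)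
  param : ∀ x ∈ X, ∀ A ∈ X, x ∈ DefSetA ∅ A → ∃ (n : ℕ) (φ : Fml (n + 1)) (v : Fin n → ZFSet.{0}),
    (∀ i, v i ∈ X) ∧ (∀ i, v i ∈ A) ∧ x = defSub A φ v

lemma LClosed.collapse_defSub (hX : LClosed X) {A : ZFSet.{0}} (hA : A ∈ X) {n : ℕ}
    (φ : Fml (n + 1)) {v : Fin n → ZFSet.{0}} (hv : ∀ i, v i ∈ X) (hvA : ∀ i, v i ∈ A) :
    collapse X (defSub A φ v) = defSub (collapse X A) φ (fun i => collapse X (v i)) := by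
  have himg : (collapse X A).toSet = collapse X '' (A.toSet ∩ X.toSet) := by
    ext z
    rw [mem_toSet, mem_collapse]
    exact ⟨fun ⟨w, h1, h2, h3⟩ => ⟨w, ⟨h1, h2⟩, h3⟩, fun ⟨w, ⟨h1, h2⟩, h3⟩ => ⟨w, h1, h2, h3⟩⟩
  have hsat : ∀ w ∈ A, w ∈ X → (SatAB (collapse X A).toSet ∅ ∅ φ
      (Fin.cons (collapse X w) (fun i => collapse X (v i))) ↔
      SatAB A.toSet ∅ ∅ φ (Fin.cons w v)) := by
    intro w hwA hwX
    have hmem : ∀ i, (Fin.cons w v : Fin (n + 1) → ZFSet.{0}) i ∈ A.toSet ∩ X.toSet :=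
      Fin.cases ⟨hwA, hwX⟩ fun i => ⟨hvA i, hv i⟩
    have hcons : (Fin.cons (collapse X w) (fun i => collapse X (v i)) : Fin _ → ZFSet.{0}) =
        (fun i => collapse X ((Fin.cons w v : Fin _ → ZFSet.{0}) i)) := by
      funext i
      refine Fin.cases ?_ (fun i => ?_) i <;> simp
    rw [himg, hcons, hX.ext.satAB_collapse Set.inter_subset_right φ _ hmem]
    refine sat_iff_of_witness Set.inter_subset_left (fun m ψ u hu h => ?_) φ _ hmem
    obtain ⟨x, h1, h2, h3⟩ := hX.witness A hA m ψ u (fun i => (hu i).2) h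
    exact ⟨x, ⟨h2, h1⟩, h3⟩
  ext z
  rw [mem_collapse, mem_defSub]
  constructor
  · rintro ⟨w, hw, hwX, rfl⟩
    rw [mem_defSub] at hw
    exact ⟨mem_collapse_of_mem hwX hw.1, (hsat w hw.1 hwX).2 hw.2⟩
  · rintro ⟨hz, h⟩
    obtain ⟨w, hw, hwX, rfl⟩ := mem_collapse.1 hz
    exact ⟨w, mem_defSub.2 ⟨hw, (hsat w hw hwX).1 h⟩, hwX, rfl⟩

lemma LClosed.collapse_Lstage (hX : LClosed X) {α : ZFSet.{0}} (hα : α ∈ X) :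
    collapse X (Lstage α) = Lstage (collapse X α) := by
  induction α using ZFSet.inductionOn with
  | _ α ih =>
    ext z
    rw [mem_collapse, mem_Lstage]
    constructor
    · rintro ⟨x, hx, hxX, rfl⟩
      obtain ⟨β, hβX, hβ, hxβ⟩ := hX.level x hxX α hα hx
      obtain ⟨n, φ, v, hv, hvA, rfl⟩ := hX.param x hxX _ (hX.stage β hβX) hxβ
      refine ⟨_, mem_collapse_of_mem hβX hβ, ?_⟩
      rw [hX.collapse_defSub (hX.stage β hβX) φ hv hvA, ih β hβ hβX]
      refine mem_DefSetA.2 ⟨n, φ, _, fun i => ?_, rfl⟩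
      rw [← ih β hβ hβX]
      exact mem_collapse_of_mem (hv i) (hvA i)
    · rintro ⟨_, hβ', hz⟩
      obtain ⟨β, hβ, hβX, rfl⟩ := mem_collapse.1 hβ'
      rw [← ih β hβ hβX] at hz
      obtain ⟨n, φ, u, hu, rfl⟩ := mem_DefSetA.1 hz
      have hu' := fun i => mem_collapse.1 (hu i)
      choose v hvA hv e using hu'
      obtain rfl : (fun i => collapse X (v i)) = u := funext e
      refine ⟨_, mem_Lstage.2 ⟨β, hβ, mem_DefSetA.2 ⟨n, φ, v, hvA, rfl⟩⟩,
        hX.def_mem _ (hX.stage β hβX) n φ v hv, ?_⟩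
      rw [hX.collapse_defSub (hX.stage β hβX) φ hv hvA]

/-- Parameters defining `x` over `A` through `φ`, if there are any. -/
def defParams {n : ℕ} (φ : Fml (n + 1)) (x A : ZFSet.{0}) : Fin n → ZFSet.{0} :=
  Classical.epsilon fun v => (∀ i, v i ∈ A) ∧ x = defSub A φ v

/-- The relations whose Skolem functions generate structures satisfying `LClosed`. -/
def lClosedRel (q : ℕ × Σ n : ℕ, Fml (n + 1)) (l : List ZFSet.{0}) (z : ZFSet.{0}) : Prop :=
  match q with
  | (0, _) => ∃ x y, l = [x, y] ∧ ¬ (z ∈ x ↔ z ∈ y)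
  | (1, _) => ∃ α, l = [α] ∧ z = Lstage α
  | (2, ⟨_, φ⟩) => ∃ A v, l = A :: List.ofFn v ∧ z ∈ A ∧ SatAB A.toSet ∅ ∅ φ (Fin.cons z v)
  | (3, ⟨_, φ⟩) => ∃ A v, l = A :: List.ofFn v ∧ z = defSub A φ v
  | (4, _) => ∃ x α, l = [x, α] ∧ z ∈ α ∧ x ∈ DefSetA ∅ (Lstage z)
  | (k + 5, ⟨_, φ⟩) => ∃ x A, l = [x, A] ∧ ∃ i, i.val = k ∧ z = defParams φ x A i

lemma exists_lClosed {a : ZFSet.{0}} (ha : Ctbl a) : ∃ X, a ⊆ X ∧ Ctbl X ∧ LClosed X := by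
  obtain ⟨M, haM, hM, h⟩ := exists_countable_closed lClosedRel (A := a.toSet) ha
  obtain ⟨X, hX⟩ := exists_mem_iff_of_countable hM
  simp only [← hX] at h
  have hl : ∀ {A : ZFSet.{0}} {n : ℕ} {v : Fin n → ZFSet.{0}}, A ∈ X → (∀ i, v i ∈ X) →
      ∀ z ∈ A :: List.ofFn v, z ∈ X := by
    intro A n v hA hv z hz
    rcases List.mem_cons.1 hz with rfl | hz
    · exact hA
    · obtain ⟨i, rfl⟩ := (List.mem_ofFn' _ _).1 hz
      exact hv i
  refine ⟨X, fun z hz => (hX z).2 (haM hz), hM.mono fun z hz => (hX z).1 hz, ?_, ?_, ?_, ?_, ?_, ?_⟩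
  · intro x hx y hy hxy
    by_contra hne
    obtain ⟨z, hz⟩ : ∃ z, ¬ (z ∈ x ↔ z ∈ y) := by
      by_contra! hc
      exact hne (ZFSet.ext hc)
    obtain ⟨w, hw, x', y', e, hw'⟩ := h (0, ⟨0, .eq 0 0⟩) [x, y] (by simp [hx, hy])
      ⟨z, x, y, rfl, hz⟩
    simp only [List.cons.injEq, and_true] at e
    obtain ⟨rfl, rfl⟩ := e
    exact hw' (hxy w hw)
  · intro α hα
    obtain ⟨w, hw, x', e, rfl⟩ := h (1, ⟨0, .eq 0 0⟩) [α] (by simp [hα]) ⟨_, α, rfl, rfl⟩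
    simp only [List.cons.injEq, and_true] at e
    rwa [e]
  · rintro A hA n φ v hv ⟨x, hx, hs⟩
    obtain ⟨w, hw, A', v', e, h1, h2⟩ := h (2, ⟨n, φ⟩) (A :: List.ofFn v) (hl hA hv)
      ⟨x, A, v, rfl, hx, hs⟩
    rw [List.cons.injEq, List.ofFn_inj] at e
    obtain ⟨rfl, rfl⟩ := e
    exact ⟨w, hw, h1, h2⟩
  · rintro A hA n φ v hv
    obtain ⟨w, hw, A', v', e, rfl⟩ := h (3, ⟨n, φ⟩) (A :: List.ofFn v) (hl hA hv)
      ⟨_, A, v, rfl, rfl⟩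
    rw [List.cons.injEq, List.ofFn_inj] at e
    obtain ⟨rfl, rfl⟩ := e
    exact hw
  · intro x hx α hα hxα
    obtain ⟨β, hβ, hxβ⟩ := mem_Lstage.1 hxα
    obtain ⟨w, hw, x', y', e, h1, h2⟩ := h (4, ⟨0, .eq 0 0⟩) [x, α] (by simp [hx, hα])
      ⟨β, x, α, rfl, hβ, hxβ⟩
    simp only [List.cons.injEq, and_true] at e
    obtain ⟨rfl, rfl⟩ := e
    exact ⟨w, hw, h1, h2⟩
  · intro x hx A hA hxA
    obtain ⟨n, φ, hv⟩ := mem_DefSetA.1 hxA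
    have hp : (∀ i, defParams φ x A i ∈ A) ∧ x = defSub A φ (defParams φ x A) :=
      Classical.epsilon_spec hv
    refine ⟨n, φ, defParams φ x A, fun i => ?_, hp⟩
    obtain ⟨w, hw, x', y', e, j, hj, rfl⟩ := h (i.val + 5, ⟨n, φ⟩) [x, A] (by simp [hx, hA])
      ⟨_, x, A, rfl, i, rfl, rfl⟩
    simp only [List.cons.injEq, and_true] at e
    obtain ⟨rfl, rfl⟩ := e
    rwa [← Fin.ext hj]

end Collapse

/-- A hereditarily countable constructible set belongs to a countable stage. -/
lemma exists_ctbl_stage {β t f : ZFSet.{0}} (hβ : IsOrd β) (hf : f ∈ Lstage β)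
    (ht : t.IsTransitive) (hc : Ctbl t) (hft : f ∈ t) :
    ∃ ξ, IsOrd ξ ∧ Ctbl ξ ∧ f ∈ Lstage ξ := by
  obtain ⟨X, hX, hXc, hXL⟩ := exists_lClosed (a := insert β t)
    ((Set.Countable.insert β hc).mono fun z hz => ZFSet.mem_insert_iff.1 hz)
  have hβX := hX (ZFSet.mem_insert _ _)
  have htX : t ⊆ X := fun z hz => hX (ZFSet.mem_insert_of_mem _ hz)
  refine ⟨collapse X β, hβ.collapse, ctbl_collapse hXc, ?_⟩
  rw [← hXL.collapse_Lstage hβX, ← collapse_eq_self ht htX hft]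
  exact mem_collapse_of_mem (htX hft) hf

lemma notLCardS_iff {S : Set ZFSet.{0}} (hS : CtblClosed S) {δ : ZFSet.{0}} (hδ : IsOrd δ)
    (hc : Ctbl δ) : NotLCardS S δ ↔ ¬ LCard δ := by
  refine ⟨fun h => h.not_lCard hS, fun h => ?_⟩
  have h' : ∃ α ∈ δ, ∃ f ∈ LClass, IsSurjF α δ f := by
    by_contra! hn
    exact h ⟨hδ, hn⟩
  obtain ⟨α, hα, f, ⟨β, hβ, hf⟩, hs⟩ := h'
  set κ := (Order.succ Cardinal.aleph0.{0}).ord.toZFSet with hκdef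
  have hκ : IsRegular κ := isRegular_succ le_rfl
  have hω : ZFSet.omega ∈ κ := by
    rw [omega_eq, hκdef, Ordinal.toZFSet_mem_toZFSet_iff, ← Cardinal.ord_aleph0,
      Cardinal.ord_lt_ord]
    exact Order.lt_succ _
  have hH := ctblClosed_Hset hκ hω
  have hδH := hH.ord_mem hδ hc
  have hfpair : ∀ p ∈ f, ∃ a ∈ α, ∃ b ∈ δ, p = ZFSet.pair a b := fun p hp =>
    ZFSet.mem_prod.1 (hs.1.1 hp)
  have hfH : f ∈ Hset κ := by
    refine hH.ctbl (fun p hp => ?_) ?_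
    · obtain ⟨a, ha, b, hb, rfl⟩ := hfpair p hp
      exact hH.pair (hH.trans hδH (hδ.1 α hα ha)) (hH.trans hδH hb)
    · refine (((hc.mono (hδ.1 α hα)).prod hc).image fun q => ZFSet.pair q.1 q.2).mono fun p hp => ?_
      obtain ⟨a, ha, b, hb, rfl⟩ := hfpair p hp
      exact ⟨(a, b), ⟨ha, hb⟩, rfl⟩
  obtain ⟨t, ht, hft, htc⟩ := hfH
  have htc : Ctbl t := by
    rw [ctbl_iff, ← Order.lt_succ_iff]
    have := hκ.1.cardLT_iff.1 htc
    rwa [hκdef, Ordinal.card_toZFSet, Cardinal.card_ord] at this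
  obtain ⟨ξ, hξ, hξc, hfξ⟩ := exists_ctbl_stage hβ hf ht htc hft
  exact notLCardS_of_mem_Lstage hS hξ hξc hfξ hα hs

/-! ### Order types of sets of ordinals -/

lemma collapse_congr {X Y γ : ZFSet.{0}} (hγ : γ.IsTransitive) (h : ∀ z ∈ γ, z ∈ X ↔ z ∈ Y)
    {u : ZFSet.{0}} (hu : u ⊆ γ) : collapse X u = collapse Y u := by
  induction u using ZFSet.inductionOn with
  | _ u ih =>
    ext t
    rw [mem_collapse, mem_collapse]
    refine exists_congr fun w => and_congr_right fun hw => ?_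
    rw [h w (hu hw), ih w hw (hγ w (hu hw))]

lemma IsOrd.extensional {Y : ZFSet.{0}} (hY : ∀ y ∈ Y, IsOrd y) : Extensional Y := by
  intro x hx y hy h
  rcases (hY x hx).isOrdinal.mem_trichotomous (hY y hy).isOrdinal with hxy | hxy | hxy
  · exact absurd ((h x hx).2 hxy) (ZFSet.mem_irrefl x)
  · exact hxy
  · exact absurd ((h y hy).1 hxy) (ZFSet.mem_irrefl y)

lemma IsOrd.collapse_mem_iff {γ X z w : ZFSet.{0}} (hγ : IsOrd γ) (hz : z ∈ X) (hzγ : z ∈ γ)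
    (hw : w ∈ X) (hwγ : w ∈ γ) :
    (SRPPaper.collapse X z ∈ SRPPaper.collapse X w ↔ z ∈ w) ∧
      (SRPPaper.collapse X z = SRPPaper.collapse X w → z = w) := by
  have hext : Extensional (ZFSet.sep (· ∈ γ) X) :=
    IsOrd.extensional fun y hy => hγ.mem (ZFSet.mem_sep.1 hy).2
  have hc : ∀ u ∈ γ, SRPPaper.collapse X u = SRPPaper.collapse (ZFSet.sep (· ∈ γ) X) u :=
    fun u hu => collapse_congr hγ.1 (fun t ht => by simp [ht]) (hγ.1 u hu)
  have hz' : z ∈ ZFSet.sep (· ∈ γ) X := ZFSet.mem_sep.2 ⟨hz, hzγ⟩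
  have hw' : w ∈ ZFSet.sep (· ∈ γ) X := ZFSet.mem_sep.2 ⟨hw, hwγ⟩
  rw [hc z hzγ, hc w hwγ]
  exact ⟨hext.collapse_mem hz', hext.collapse_inj hz' hw'⟩

/-- An ordinal that is order-isomorphic to `Z ∩ γ` is the collapse of `γ`. -/
lemma eq_collapse {R : ZFSet.{0} → ZFSet.{0} → Prop} {Z γ δ : ZFSet.{0}} (hδ : δ.IsTransitive)
    (h1 : ∀ z ∈ Z, z ∈ γ → ∃ η ∈ δ, R z η) (h2 : ∀ η ∈ δ, ∃ z ∈ Z, z ∈ γ ∧ R z η)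
    (h3 : ∀ z ∈ Z, ∀ w ∈ Z, z ∈ γ → w ∈ γ → ∀ η ∈ δ, ∀ ζ ∈ δ, R z η → R w ζ → (z ∈ w ↔ η ∈ ζ))
    (hγ : γ.IsTransitive) : δ = collapse Z γ := by
  have key : ∀ z ∈ Z, z ∈ γ → ∀ η ∈ δ, R z η → η = collapse Z z := by
    intro z
    induction z using ZFSet.inductionOn with
    | _ z ih =>
      intro hz hzγ η hη hR
      ext t
      rw [mem_collapse]
      constructor
      · intro ht
        obtain ⟨w, hw, hwγ, hwt⟩ := h2 t (hδ η hη ht)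
        have hwz := (h3 w hw z hz hwγ hzγ t (hδ η hη ht) η hη hwt hR).2 ht
        exact ⟨w, hwz, hw, (ih w hwz hw hwγ t (hδ η hη ht) hwt).symm⟩
      · rintro ⟨w, hwz, hw, rfl⟩
        obtain ⟨s, hs, hws⟩ := h1 w hw (hγ z hzγ hwz)
        rw [← ih w hwz hw (hγ z hzγ hwz) s hs hws]
        exact (h3 w hw z hz (hγ z hzγ hwz) hzγ s hs η hη hws hR).1 hwz
  ext t
  rw [mem_collapse]
  constructor
  · intro ht
    obtain ⟨w, hw, hwγ, hwt⟩ := h2 t ht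
    exact ⟨w, hwγ, hw, (key w hw hwγ t ht hwt).symm⟩
  · rintro ⟨w, hwγ, hw, rfl⟩
    obtain ⟨s, hs, hws⟩ := h1 w hw hwγ
    rwa [← key w hw hwγ s hs hws]

lemma IsOrd.otype_eq {Y γ : ZFSet.{0}} (hγ : IsOrd γ) (hY : Y ⊆ γ) :
    otype Y = SRPPaper.collapse Y γ := by
  have hex : ∃ α, IsOrd α ∧ ∃ e : Y.toSet ≃ α.toSet, ∀ a b : Y.toSet,
      (a : ZFSet.{0}) ∈ (b : ZFSet.{0}) ↔ ((e a : ZFSet.{0}) ∈ (e b : ZFSet.{0})) := by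
    refine ⟨SRPPaper.collapse Y γ, hγ.collapse, Equiv.ofBijective
      (fun a => ⟨SRPPaper.collapse Y a, mem_collapse_of_mem a.2 (hY a.2)⟩) ⟨?_, ?_⟩, ?_⟩
    · intro a b hab
      exact Subtype.ext ((hγ.collapse_mem_iff a.2 (hY a.2) b.2 (hY b.2)).2 (Subtype.ext_iff.1 hab))
    · rintro ⟨t, ht⟩
      obtain ⟨w, -, hw, rfl⟩ := mem_collapse.1 ht
      exact ⟨⟨w, hw⟩, rfl⟩
    · exact fun a b => (hγ.collapse_mem_iff a.2 (hY a.2) b.2 (hY b.2)).1.symm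
  rw [otype, dif_pos hex]
  have hspec := hex.choose_spec
  generalize hex.choose = α at hspec ⊢
  obtain ⟨hα, e, he⟩ := hspec
  refine eq_collapse (R := fun z η => ∃ h : z ∈ Y, (e ⟨z, h⟩ : ZFSet.{0}) = η) hα.1 ?_ ?_ ?_ hγ.1
  · exact fun z hz _ => ⟨_, (e ⟨z, hz⟩).2, hz, rfl⟩
  · intro η hη
    refine ⟨_, (e.symm ⟨η, hη⟩).2, hY (e.symm ⟨η, hη⟩).2, (e.symm ⟨η, hη⟩).2, ?_⟩
    rw [Subtype.coe_eta, Equiv.apply_symm_apply]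
  · rintro z hz w hw - - η - ζ - ⟨_, rfl⟩ ⟨_, rfl⟩
    exact he ⟨z, hz⟩ ⟨w, hw⟩

lemma OrdIso.eq_collapse {e Z γ δ : ZFSet.{0}} (hγ : IsOrd γ) (hδ : IsOrd δ)
    (h : OrdIso e Z γ δ) : δ = collapse Z γ :=
  SRPPaper.eq_collapse (R := fun z η => ZFSet.pair z η ∈ e) hδ.1 h.1 h.2.1 h.2.2 hγ.1

lemma exists_ordIso {S : Set ZFSet.{0}} (hS : CtblClosed S) {Z γ : ZFSet.{0}} (hγ : IsOrd γ)
    (hZ : Z ∈ S) (hc : Ctbl Z) : ∃ e ∈ S, OrdIso e Z γ (collapse Z γ) := by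
  have hcol : collapse Z γ ∈ S := hS.ord_mem hγ.collapse (ctbl_collapse hc)
  have hmem : ∀ {p : ZFSet.{0}}, p ∈ img (fun z => ZFSet.pair z (collapse Z z))
      (ZFSet.sep (· ∈ γ) Z) ↔ ∃ z ∈ Z, z ∈ γ ∧ ZFSet.pair z (collapse Z z) = p := by
    simp [and_assoc]
  refine ⟨_, hS.ctbl (fun p hp => ?_) (ctbl_img (hc.mono fun z hz => (ZFSet.mem_sep.1 hz).1)),
    fun z hz hzγ => ⟨_, mem_collapse_of_mem hz hzγ, hmem.2 ⟨z, hz, hzγ, rfl⟩⟩, fun η hη => ?_,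
    fun z hz w hw hzγ hwγ η _ ζ _ h1 h2 => ?_⟩
  · obtain ⟨z, hz, hzγ, rfl⟩ := hmem.1 hp
    exact hS.pair (hS.trans hZ hz) (hS.trans hcol (mem_collapse_of_mem hz hzγ))
  · obtain ⟨w, hw, hwZ, rfl⟩ := mem_collapse.1 hη
    exact ⟨w, hwZ, hw, hmem.2 ⟨w, hwZ, hw, rfl⟩⟩
  · obtain ⟨z', -, -, e1⟩ := hmem.1 h1
    obtain ⟨w', -, -, e2⟩ := hmem.1 h2
    obtain ⟨rfl, rfl⟩ := ZFSet.pair_inj.1 e1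
    obtain ⟨rfl, rfl⟩ := ZFSet.pair_inj.1 e2
    exact (hγ.collapse_mem_iff hz hzγ hw hwγ).1.symm

/-! ### From elementary submodels to closed sets of ordinals -/

lemma ElemSub.exists_mem {X : ZFSet.{0}} {S : Set ZFSet.{0}} (h : ElemSub X S) {n : ℕ}
    {P : ZFSet.{0} → (Fin n → ZFSet.{0}) → Prop}
    (hP : Dfb S fun w : Fin (n + 1) → ZFSet.{0} => P (w 0) fun i => w i.succ)
    {v : Fin n → ZFSet.{0}} (hv : ∀ i, v i ∈ X) (hex : ∃ x ∈ S, P x v) : ∃ x ∈ X, P x v := by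
  obtain ⟨φ, hφ⟩ := hP
  have hφ' : ∀ x ∈ S, Sat S φ (Fin.cons x v) ↔ P x v := fun x hx =>
    hφ (Fin.cons x v) (Fin.cases hx fun i => h.1 (hv i))
  obtain ⟨x, hx, hPx⟩ := hex
  obtain ⟨y, hy, hs⟩ := (h.2 (.ex φ) v hv).2 ⟨x, hx, (hφ' x hx).2 hPx⟩
  exact ⟨y, hy, (hφ' y (h.1 hy)).1 ((h.2 φ (Fin.cons y v) (Fin.cases hy hv)).1 hs)⟩

lemma codeL_mem_of_pair {Z : ZFSet.{0}} (h0 : ∅ ∈ Z)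
    (h : ∀ a ∈ Z, ∀ s ∈ Z, ∃ q ∈ Z, q = ZFSet.pair a s) {l : List ZFSet.{0}}
    (hl : ∀ z ∈ l, z ∈ Z) : codeL l ∈ Z := by
  induction l with
  | nil => exact h0
  | cons a l ih =>
    obtain ⟨q, hq, rfl⟩ := h a (hl a List.mem_cons_self) _
      (ih fun z hz => hl z (List.mem_cons_of_mem _ hz))
    exact hq

/-- The graph of `F` on the finite sequences of elements of `γ`. -/
def graphL (F : List ZFSet.{0} → ZFSet.{0}) (γ : ZFSet.{0}) : ZFSet.{0} :=
  ZFSet.range fun l : List γ => ZFSet.pair (codeL (l.map (·.1))) (F (l.map (·.1)))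

lemma pair_mem_graphL {F : List ZFSet.{0} → ZFSet.{0}} {γ y : ZFSet.{0}} {l : List ZFSet.{0}} :
    ZFSet.pair (codeL l) y ∈ graphL F γ ↔ (∀ z ∈ l, z ∈ γ) ∧ y = F l := by
  rw [graphL, ZFSet.mem_range]
  constructor
  · rintro ⟨m, hm⟩
    obtain ⟨h1, rfl⟩ := ZFSet.pair_inj.1 hm
    obtain rfl := codeL_injective h1
    refine ⟨fun z hz => ?_, rfl⟩
    obtain ⟨a, -, rfl⟩ := List.mem_map.1 hz
    exact a.2
  · rintro ⟨hl, rfl⟩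
    obtain ⟨m, rfl⟩ := CanLift.prf (β := List γ) l hl
    exact ⟨m, rfl⟩

lemma graphL_mem {κ : ZFSet.{0}} (hκ : IsRegular κ) (hω : ZFSet.omega ∈ κ) {γ : ZFSet.{0}}
    (hγ : γ ∈ κ) {F : List ZFSet.{0} → ZFSet.{0}}
    (hF : ∀ l : List ZFSet.{0}, (∀ z ∈ l, z ∈ γ) → F l ∈ γ) : graphL F γ ∈ Hset κ := by
  have hS := ctblClosed_Hset hκ hω
  have hγS := Hset.mem_of_mem hκ hγ hω
  refine Hset.mem_of_card_lt hκ hω (fun z hz => ?_) ?_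
  · obtain ⟨l, rfl⟩ := ZFSet.mem_range.1 hz
    have hl : ∀ z ∈ l.map (·.1), z ∈ γ := fun z hz => by
      obtain ⟨a, -, rfl⟩ := List.mem_map.1 hz
      exact a.2
    exact hS.pair (hS.codeL_mem fun z hz => hS.trans hγS (hl z hz)) (hS.trans hγS (hF _ hl))
  · refine lt_of_le_of_lt ?_ (max_lt (aleph0_lt hκ hω) (hκ.1.card_lt hγ))
    rw [← Cardinal.lift_le.{1}]
    refine ZFSet.lift_card_range_le.trans ?_
    rw [Cardinal.lift_id'.{0, 1}, Cardinal.lift_max, Cardinal.lift_aleph0,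
      ← ZFSet.cardinalMk_coe_sort]
    exact Cardinal.mk_list_le_max _

lemma noReflectS_graphL {S : Set ZFSet.{0}} (hS : CtblClosed S) {γ : ZFSet.{0}} (hγ : IsOrd γ)
    {F : List ZFSet.{0} → ZFSet.{0}} (hF : ∀ l : List ZFSet.{0}, (∀ z ∈ l, z ∈ γ) → F l ∈ γ)
    (hγS : γ ∈ S)
    (hno : ∀ Y : ZFSet.{0}, Y ⊆ γ → Ctbl Y → (∀ l : List ZFSet.{0}, (∀ z ∈ l, z ∈ Y) → F l ∈ Y) →
      ¬ LCard (otype Y)) : NoReflectS S (graphL F γ) γ := by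
  intro Z hZ hZc h0 hp hcl
  have hc := (ctblS_iff hS hZ).1 hZc
  refine ⟨collapse Z γ, hS.ord_mem hγ.collapse (ctbl_collapse hc), hγ.collapse,
    exists_ordIso hS hγ hZ hc, (notLCardS_iff hS hγ.collapse (ctbl_collapse hc)).2 ?_⟩
  have hsub : ZFSet.sep (· ∈ γ) Z ⊆ γ := fun z hz => (ZFSet.mem_sep.1 hz).2
  have h := hno _ hsub (hc.mono fun z hz => (ZFSet.mem_sep.1 hz).1) fun l hl => by
    have hlZ : ∀ z ∈ l, z ∈ Z := fun z hz => (ZFSet.mem_sep.1 (hl z hz)).1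
    have hlγ : ∀ z ∈ l, z ∈ γ := fun z hz => (ZFSet.mem_sep.1 (hl z hz)).2
    obtain ⟨y, hy, hyF⟩ := hcl _ (codeL_mem_of_pair h0 hp hlZ)
      ⟨F l, hS.trans hγS (hF l hlγ), pair_mem_graphL.2 ⟨hlγ, rfl⟩⟩
    obtain ⟨-, rfl⟩ := pair_mem_graphL.1 hyF
    exact ZFSet.mem_sep.2 ⟨hy, hF l hlγ⟩
  rwa [hγ.otype_eq hsub, ← collapse_congr (X := Z) hγ.1 (fun t ht => by simp [ht]) subset_rfl] at h

lemma WRPL.exists_closed {γ : ZFSet.{0}} (hγ : IsOrd γ) (hω : ZFSet.omega ∈ γ) (h : WRPL γ)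
    {F : List ZFSet.{0} → ZFSet.{0}} (hF : ∀ l : List ZFSet.{0}, (∀ z ∈ l, z ∈ γ) → F l ∈ γ) :
    ∃ Y : ZFSet.{0}, Y ⊆ γ ∧ Ctbl Y ∧
      (∀ l : List ZFSet.{0}, (∀ z ∈ l, z ∈ Y) → F l ∈ Y) ∧ LCard (otype Y) := by
  obtain ⟨κ, hκ, hγκ, X, hX, hXc, hγX, hL⟩ := h
  by_contra! hno
  have hωκ : ZFSet.omega ∈ κ := hκ.1.1.1 γ hγκ hω
  have hS := ctblClosed_Hset hκ hωκ
  have hP := hS.toPairClosed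
  have hXS : X ∈ Hset κ := hS.ctbl hX.1 hXc.1
  have hγS := hX.1 hγX
  obtain ⟨G, hG, hGR⟩ := hX.exists_mem (P := fun x v => NoReflectS (Hset κ) x (v 0)) (n := 1)
    (Dfb.noReflectS hP 0 1) (v := fun _ => γ) (fun _ => hγX)
    ⟨_, graphL_mem hκ hωκ hγκ hF, noReflectS_graphL hS hγ hF hγS hno⟩
  obtain ⟨δ, hδS, hδ, ⟨e, -, he⟩, hδL⟩ := hGR X hXS ((ctblS_iff hS hXS).2 hXc.1)
    (by
      obtain ⟨x, hx, rfl⟩ := hX.exists_mem (P := fun x _ => x = ∅) (n := 0)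
        (Dfb.eq_empty hP 0) (v := Fin.elim0) (fun i => i.elim0) ⟨∅, hS.empty_mem, rfl⟩
      exact hx)
    (fun a ha s hs => hX.exists_mem (P := fun x v => x = ZFSet.pair (v 0) (v 1)) (n := 2)
      (Dfb.eq_pair hP 0 1 2) (v := ![a, s]) (fun i => by fin_cases i <;> assumption)
      ⟨_, hS.pair (hX.1 ha) (hX.1 hs), rfl⟩)
    (fun s hs hex => hX.exists_mem (P := fun x v => ZFSet.pair (v 0) x ∈ v 1) (n := 2)
      (Dfb.pair_mem hP 1 0 2) (v := ![s, G]) (fun i => by fin_cases i <;> assumption) hex)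
  rw [he.eq_collapse hγ hδ] at hδL
  exact (notLCardS_iff hS hγ.collapse (ctbl_collapse hXc.1)).1 hδL hL

/-! ### From closed sets of ordinals to elementary submodels in a club -/

/-- A set closed under one function on finite sequences can be closed under countably many. -/
lemma exists_hull_subset {p : ZFSet.{0} → Prop} {γ : ZFSet.{0}} (h0 : ∅ ∈ γ)
    (h : ∀ F : List ZFSet.{0} → ZFSet.{0},
      (∀ l : List ZFSet.{0}, (∀ z ∈ l, z ∈ γ) → F l ∈ γ) →
      ∃ X : ZFSet.{0}, X ⊆ γ ∧ Ctbl X ∧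
        (∀ l : List ZFSet.{0}, (∀ z ∈ l, z ∈ X) → F l ∈ X) ∧ p X)
    {ι : Type} [Countable ι] (f : ι → List ZFSet.{0} → ZFSet.{0}) :
    ∃ Y : ZFSet.{0}, Y ⊆ γ ∧ Ctbl Y ∧ (∀ z ∈ γ, Hull f Y.toSet z → z ∈ Y) ∧ p Y := by
  have henum : ∀ l : List ZFSet.{0}, ∃ e : ℕ → ZFSet.{0},
      {z | Hull f {a | a ∈ l} z} ⊆ Set.range e :=
    fun l => Set.countable_iff_exists_subset_range.1
      (Hull.countable f (List.finite_toSet l).countable)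
  choose e he using henum
  obtain ⟨Y, hYγ, hYc, hY, hp⟩ := h (fun l =>
    if e (l.take l.length.unpair.2) l.length.unpair.1 ∈ γ
    then e (l.take l.length.unpair.2) l.length.unpair.1 else ∅) fun l _ => by
      split_ifs with hl
      exacts [hl, h0]
  refine ⟨Y, hYγ, hYc, fun z hzγ hz => ?_, hp⟩
  obtain ⟨l, hl, hlz⟩ := hz.exists_list
  obtain ⟨k, rfl⟩ := he l hlz
  have hy := hY [] (by simp)
  set y := _
  change y ∈ Y at hy
  set m := Nat.pair k l.length with hm
  have hlen : (l ++ List.replicate (m - l.length) y).length = m := by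
    have := Nat.right_le_pair k l.length
    simp only [List.length_append, List.length_replicate]
    omega
  have := hY (l ++ List.replicate (m - l.length) y) fun z hz => by
    rcases List.mem_append.1 hz with hz | hz
    · exact hl z hz
    · rwa [(List.mem_replicate.1 hz).2]
  rwa [hlen, hm, Nat.unpair_pair, List.take_left, if_pos hzγ] at this

/-- A choice of `z ∈ S` satisfying `R i l z`, defaulting to `c`. -/
def chooseOp {ι : Type} (S : Set ZFSet.{0}) (c : ZFSet.{0})
    (R : ι → List ZFSet.{0} → ZFSet.{0} → Prop) (i : ι) (l : List ZFSet.{0}) : ZFSet.{0} :=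
  if h : ∃ z ∈ S, R i l z then h.choose else c

section ChooseOp

variable {ι : Type} {S : Set ZFSet.{0}} {c : ZFSet.{0}} {R : ι → List ZFSet.{0} → ZFSet.{0} → Prop}
  {i : ι} {l : List ZFSet.{0}}

lemma chooseOp_spec (h : ∃ z ∈ S, R i l z) : R i l (chooseOp S c R i l) := by
  rw [chooseOp, dif_pos h]
  exact h.choose_spec.2

lemma chooseOp_of_not (h : ¬ ∃ z ∈ S, R i l z) : chooseOp S c R i l = c := by
  rw [chooseOp, dif_neg h]

lemma chooseOp_mem (hc : c ∈ S) : chooseOp S c R i l ∈ S := by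
  unfold chooseOp
  split_ifs with h
  exacts [h.choose_spec.1, hc]

lemma Hull.chooseOp_mem (hc : c ∈ S) {A : Set ZFSet.{0}} (hA : A ⊆ S) {z : ZFSet.{0}}
    (hz : Hull (chooseOp S c R) A z) : z ∈ S := by
  cases hz with
  | base hz => exact hA hz
  | op i l _ => exact SRPPaper.chooseOp_mem hc

end ChooseOp

lemma infinite_omega : (ZFSet.omega : ZFSet.{0}).toSet.Infinite :=
  
  (Set.infinite_range_of_injective natZ_injective).mono <| by
    rintro _ ⟨n, rfl⟩
    exact mem_omega.2 ⟨n, rfl⟩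

lemma ClubSub.exists_superset {S D : Set ZFSet.{0}} (hD : ClubSub S D) (hS : CtblClosed S)
    {x : ZFSet.{0}} (hx : x.toSet ⊆ S) (hc : Ctbl x) : ∃ Y ∈ D, x ⊆ Y := by
  have hω : ZFSet.omega ∈ S := hS.ord_mem isOrd_omega ctbl_omega
  obtain ⟨Y, hY, hxY⟩ := hD.2.1 (x ∪ ZFSet.omega)
    (fun z hz => (ZFSet.mem_union.1 hz).elim (fun h => hx h) fun h => hS.trans hω h)
    ⟨(hc.union ctbl_omega).mono fun z hz => ZFSet.mem_union.1 hz,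
      infinite_omega.mono fun z hz => ZFSet.mem_union.2 (Or.inr hz)⟩
  exact ⟨Y, hY, fun z hz => hxY (ZFSet.mem_union.2 (Or.inl hz))⟩

lemma ClubSub.exists_directed {S D : Set ZFSet.{0}} (hD : ClubSub S D) (hS : CtblClosed S) :
    ∃ K : List ZFSet.{0} → ZFSet.{0}, ∀ l : List ZFSet.{0}, (∀ z ∈ l, z ∈ S) →
      K l ∈ D ∧ ∀ a ∈ S, a ∈ K (a :: l) ∧ K l ⊆ K (a :: l) := by
  have hex : ∀ x : ZFSet.{0}, ∃ Y, x.toSet ⊆ S → Ctbl x → Y ∈ D ∧ x ⊆ Y := by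
    intro x
    by_cases h : x.toSet ⊆ S ∧ Ctbl x
    · obtain ⟨Y, hY⟩ := hD.exists_superset hS h.1 h.2
      exact ⟨Y, fun _ _ => hY⟩
    · exact ⟨∅, fun h1 h2 => absurd ⟨h1, h2⟩ h⟩
  choose g hg using hex
  have hins : ∀ {a k : ZFSet.{0}}, a ∈ S → k ∈ D →
      g (insert a k) ∈ D ∧ insert a k ⊆ g (insert a k) := fun {a k} ha hk =>
    hg _ (fun z hz => (ZFSet.mem_insert_iff.1 hz).elim (fun h => h ▸ ha) fun h => (hD.1 k hk).1 h)
      (((hD.1 k hk).2.1.insert a).mono fun z hz => ZFSet.mem_insert_iff.1 hz)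
  let K : List ZFSet.{0} → ZFSet.{0} := List.foldr (fun a k => g (insert a k)) (g ∅)
  have hK : ∀ l : List ZFSet.{0}, (∀ z ∈ l, z ∈ S) → K l ∈ D := by
    intro l hl
    induction l with
    | nil =>
      exact (hg ∅ (fun z hz => absurd hz (ZFSet.notMem_empty z))
        (Set.countable_empty.mono fun z hz => absurd hz (ZFSet.notMem_empty z))).1
    | cons a l ih =>
      exact (hins (hl a List.mem_cons_self) (ih fun z hz => hl z (List.mem_cons_of_mem _ hz))).1
  refine ⟨K, fun l hl => ⟨hK l hl, fun a ha => ?_⟩⟩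
  have h := (hins ha (hK l hl)).2
  exact ⟨h (ZFSet.mem_insert _ _), fun z hz => h (ZFSet.mem_insert_of_mem _ hz)⟩

/-- The relations whose choice functions are Skolem functions for `S` and enumerations `e l`. -/
def skolemRel (S : Set ZFSet.{0}) (e : List ZFSet.{0} → ℕ → ZFSet.{0})
    (q : ℕ × Σ n : ℕ, Fml (n + 1)) (l : List ZFSet.{0}) (z : ZFSet.{0}) : Prop :=
  match q with
  | (0, ⟨_, φ⟩) => ∃ v, l = List.ofFn v ∧ SatAB S ∅ ∅ φ (Fin.cons z v)
  | (k + 1, _) => z = e l k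

lemma statSub_of_closed {γ κ : ZFSet.{0}} (hγ : IsOrd γ) (hω : ZFSet.omega ∈ γ)
    (hκ : IsRegular κ) (hγκ : γ ∈ κ)
    (h : ∀ F : List ZFSet.{0} → ZFSet.{0},
      (∀ l : List ZFSet.{0}, (∀ z ∈ l, z ∈ γ) → F l ∈ γ) →
      ∃ X : ZFSet.{0}, X ⊆ γ ∧ Ctbl X ∧
        (∀ l : List ZFSet.{0}, (∀ z ∈ l, z ∈ X) → F l ∈ X) ∧ LCard (otype X)) :
    StatSub (Hset κ)
      {X | ElemSub X (Hset κ) ∧ CtblInf X ∧ γ ∈ X ∧ LCard (collapse X γ)} := by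
  intro D hD
  have hωκ : ZFSet.omega ∈ κ := hκ.1.1.1 γ hγκ hω
  have hS := ctblClosed_Hset hκ hωκ
  have hγS := Hset.mem_of_mem hκ hγκ hωκ
  set S := Hset κ
  obtain ⟨K, hK⟩ := hD.exists_directed hS
  have henum : ∀ l : List ZFSet.{0}, ∃ e : ℕ → ZFSet.{0}, (∀ z ∈ l, z ∈ S) →
      (K l).toSet ⊆ Set.range e := by
    intro l
    by_cases hl : ∀ z ∈ l, z ∈ S
    · obtain ⟨e, he⟩ := Set.countable_iff_exists_subset_range.1 (hD.1 _ (hK l hl).1).2.1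
      exact ⟨e, fun _ => he⟩
    · exact ⟨fun _ => ∅, fun h => absurd h hl⟩
  choose e he using henum
  set f := chooseOp S γ (skolemRel S e) with hf
  obtain ⟨Y, hYγ, hYc, hY, hL⟩ := exists_hull_subset
    (hγ.1 _ hω (mem_omega.2 ⟨0, rfl⟩) : (∅ : ZFSet.{0}) ∈ γ) h f
  have hYS : Y.toSet ⊆ S := fun z hz => hS.trans hγS (hYγ hz)
  obtain ⟨X, hX⟩ := exists_mem_iff_of_countable (Hull.countable f hYc)
  have hX : ∀ z, z ∈ X ↔ Hull f Y.toSet z := hX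
  have hXS : ∀ z ∈ X, z ∈ S := fun z hz => ((hX z).1 hz).chooseOp_mem hγS hYS
  have hXop : ∀ i l, (∀ z ∈ l, z ∈ X) → f i l ∈ X := fun i l hl =>
    (hX _).2 (.op i l fun z hz => (hX z).1 (hl z hz))
  have hγX : γ ∈ X := by
    have : f (0, ⟨0, .not (.eq 0 0)⟩) [] = γ := chooseOp_of_not fun ⟨z, _, v, _, hv⟩ => hv rfl
    exact this ▸ hXop _ [] (by simp)
  have hKX : ∀ l : List ZFSet.{0}, (∀ z ∈ l, z ∈ X) → K l ⊆ X := by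
    intro l hl z hz
    have hlS := fun z hz => hXS z (hl z hz)
    obtain ⟨k, rfl⟩ := he l hlS hz
    have : f (k + 1, ⟨0, .eq 0 0⟩) l = e l k :=
      chooseOp_spec (R := skolemRel S e) (i := (k + 1, ⟨0, .eq 0 0⟩)) (l := l)
        ⟨e l k, (hD.1 _ (hK l hlS).1).1 hz, rfl⟩
    exact this ▸ hXop _ l hl
  have hXD : X ∈ D := by
    obtain ⟨x, hx⟩ := ((Hull.countable f hYc).mono fun z hz => (hX z).1 hz :
      X.toSet.Countable).exists_eq_range ⟨γ, hγX⟩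
    have hxX : ∀ n, x n ∈ X := fun n => (hx ▸ Set.mem_range_self n : x n ∈ X.toSet)
    let L : ℕ → List ZFSet.{0} := fun n => Nat.rec [] (fun k l => x k :: l) n
    have hL : ∀ n, ∀ z ∈ L n, z ∈ X := by
      intro n
      induction n with
      | zero => simp [L]
      | succ n ih => exact List.forall_mem_cons.2 ⟨hxX n, ih⟩
    have hLS := fun n z hz => hXS z (hL n z hz)
    have hu : seqUnion (fun n => K (L n)) = X := by
      ext z
      rw [mem_seqUnion]
      constructor
      · rintro ⟨n, hn⟩
        exact hKX _ (hL n) hn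
      · intro hz
        obtain ⟨n, rfl⟩ : z ∈ Set.range x := hx ▸ hz
        exact ⟨n + 1, ((hK _ (hLS n)).2 _ (hXS _ (hxX n))).1⟩
    exact hu ▸ hD.2.2 _ (fun n => (hK _ (hLS n)).1) fun n =>
      ((hK _ (hLS n)).2 _ (hXS _ (hxX n))).2
  refine ⟨X, ⟨⟨hXS, fun φ v hv => ?_⟩, (hD.1 X hXD).2, hγX, ?_⟩, hXD⟩
  · refine sat_iff_of_witness hXS (fun n φ v hv hex => ?_) φ v hv
    obtain ⟨v', e1, h1⟩ := chooseOp_spec (c := γ) (R := skolemRel S e) (i := (0, ⟨n, φ⟩))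
      (l := List.ofFn v) (S := S) <| by
        obtain ⟨x, hx, hs⟩ := hex
        exact ⟨x, hx, v, rfl, hs⟩
    rw [List.ofFn_inj] at e1
    subst e1
    refine ⟨_, hXop _ _ fun z hz => ?_, h1⟩
    obtain ⟨i, rfl⟩ := (List.mem_ofFn' _ _).1 hz
    exact hv i
  · rwa [hγ.otype_eq hYγ, ← collapse_congr (X := X) hγ.1 (fun z hz => ?_) subset_rfl] at hL
    rw [hX]
    exact ⟨hY z hz, fun h => .base h⟩

/-! ### Stationarity and existence -/

lemma StatSub.exists_mem {S C : Set ZFSet.{0}} (h : StatSub S C) : ∃ X, X ∈ C := by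
  have hclub : ClubSub S {X | X.toSet ⊆ S ∧ CtblInf X} := by
    refine ⟨fun X hX => hX, fun X h1 h2 => ⟨X, ⟨h1, h2⟩, subset_rfl⟩,
      fun f hf _ => ⟨fun z hz => ?_, ?_, ?_⟩⟩
    · obtain ⟨n, hn⟩ := mem_seqUnion.1 hz
      exact (hf n).1 hn
    · exact (Set.countable_iUnion fun n => (hf n).2.1).mono fun z hz =>
        Set.mem_iUnion.2 (mem_seqUnion.1 hz)
    · exact (hf 0).2.2.mono fun z hz => mem_seqUnion.2 ⟨0, hz⟩
  obtain ⟨X, hX, -⟩ := h _ hclub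
  exact ⟨X, hX⟩

/-! ## The statement -/

/-- Proposition 2.8: equivalent characterizations of `WRP^L(γ)` for an
`L`-cardinal `γ ≥ ω₁`. -/
theorem statement2 (γ : ZFSet.{0}) (hγ : Aleph 1 ∈ γ ∨ Aleph 1 = γ) (hL : LCard γ) :
    List.TFAE
      [WRPL γ,
       ∀ κ, IsRegular κ → γ ∈ κ →
         ∃ X : ZFSet.{0}, ElemSub X (Hset κ) ∧ CtblInf X ∧ γ ∈ X ∧ LCard (collapse X γ),
       ∃ κ, IsRegular κ ∧ γ ∈ κ ∧
         StatSub (Hset κ)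
           {X | ElemSub X (Hset κ) ∧ CtblInf X ∧ γ ∈ X ∧ LCard (collapse X γ)},
       ∀ F : List ZFSet.{0} → ZFSet.{0},
         (∀ l : List ZFSet.{0}, (∀ z ∈ l, z ∈ γ) → F l ∈ γ) →
         ∃ X : ZFSet.{0}, X ⊆ γ ∧ Ctbl X ∧
           (∀ l : List ZFSet.{0}, (∀ z ∈ l, z ∈ X) → F l ∈ X) ∧ LCard (otype X),
       ∀ κ, IsRegular κ → γ ∈ κ →
         StatSub (Hset κ)
           {X | ElemSub X (Hset κ) ∧ CtblInf X ∧ γ ∈ X ∧ LCard (collapse X γ)}] := by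
  have hγ' : IsOrd γ := hL.1
  have hω : ZFSet.omega ∈ γ := by
    rcases hγ with h | h
    · exact hγ'.1 _ h omega_mem_Aleph_one
    · exact h ▸ omega_mem_Aleph_one
  tfae_have 1 → 4 := fun h F hF => h.exists_closed hγ' hω hF
  tfae_have 4 → 5 := fun h κ hκ hγκ => statSub_of_closed hγ' hω hκ hγκ h
  tfae_have 5 → 2 := fun h κ hκ hγκ => (h κ hκ hγκ).exists_mem
  tfae_have 2 → 1 := fun h => by
    obtain ⟨κ, hκ, hγκ⟩ := exists_isRegular hγ'
    exact ⟨κ, hκ, hγκ, h κ hκ hγκ⟩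
  tfae_have 5 → 3 := fun h => by
    obtain ⟨κ, hκ, hγκ⟩ := exists_isRegular hγ'
    exact ⟨κ, hκ, hγκ, h κ hκ hγκ⟩
  tfae_have 3 → 1 := fun ⟨κ, hκ, hγκ, h⟩ => ⟨κ, hκ, hγκ, h.exists_mem⟩
  tfae_finish

end SRPPaper
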